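/- arXiv:2508.02859 — 3 statements merged into one kernel-verified Lean document; each statement's English description precedes it below -/
import Mathlib

section
/- Let p be an odd prime, q = p^r with q ≡ 1 (mod 4), and s = v₂(q−1). Let k be a field of characteristic ≠ 2 and let ζ be a primitive 2^s-th root of unity in a fixed algebraic closure of k. Then for every n ≥ 1 and every Sylow 2-subgroup P of GL_n(F_q), the minimal faithful representation dimension of P over k equals n·[k(ζ):k]. (This is the representation-theoretic content of ed_k(GL_n(F_q);2) = n[k(ζ_{2^s}):k].) -/
/-- The minimal faithful representation dimension of a group `G` over a field `k`:
the least `d` such that there is an injective group homomorphism `G →* GL d k`. -/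
noncomputable def minFaithfulDim (k : Type*) [Field k] (G : Type*) [Group G] : ℕ :=
  sInf {d : ℕ | ∃ φ : G →* Matrix.GeneralLinearGroup (Fin d) k, Function.Injective φ}

theorem padicValNat_two_pow_sub_one {q m : ℕ} (hq : q % 4 = 1) (hq1 : 1 < q) (hm : m ≠ 0) :
    padicValNat 2 (q ^ m - 1) = padicValNat 2 (q - 1) + padicValNat 2 m := by
  have hqm : 1 < q ^ m := Nat.one_lt_pow hm hq1
  have h := Int.two_pow_sub_pow' (x := q) (y := 1) m (by omega) (by omega)
  have h1 : ((q : ℤ) ^ m - 1 ^ m) = ((q ^ m - 1 : ℕ) : ℤ) := by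
    rw [Nat.cast_sub hqm.le]; simp
  have h2 : ((q : ℤ) - 1) = ((q - 1 : ℕ) : ℤ) := by
    rw [Nat.cast_sub hq1.le]; simp
  rw [h1, h2, show (2 : ℤ) = ((2 : ℕ) : ℤ) from rfl, Int.natCast_emultiplicity,
    Int.natCast_emultiplicity, Int.natCast_emultiplicity, ← padicValNat_eq_emultiplicity (by omega),
    ← padicValNat_eq_emultiplicity (by omega), ← padicValNat_eq_emultiplicity hm] at h
  exact_mod_cast h

theorem prod_range_pow_sub_pow_succ (q n : ℕ) :
    ∏ i ∈ Finset.range (n + 1), (q ^ (n + 1) - q ^ i) =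
      q ^ n * (∏ i ∈ Finset.range n, (q ^ n - q ^ i)) * (q ^ (n + 1) - 1) := by
  rw [Finset.prod_range_succ', pow_zero]
  congr 1
  have (i : ℕ) : q ^ (n + 1) - q ^ (i + 1) = q * (q ^ n - q ^ i) := by
    rw [Nat.mul_sub]; ring_nf
  simp_rw [this, Finset.prod_mul_distrib, Finset.prod_const, Finset.card_range]

theorem prod_range_pow_sub_pow_ne_zero {q : ℕ} (hq1 : 1 < q) (n : ℕ) :
    ∏ i ∈ Finset.range n, (q ^ n - q ^ i) ≠ 0 := by
  refine Finset.prod_ne_zero_iff.2 fun i hi ↦ ?_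
  have := Nat.pow_lt_pow_right hq1 (Finset.mem_range.1 hi)
  omega

theorem padicValNat_two_prod_range_pow_sub_pow {q : ℕ} (hq : q % 4 = 1) (hq1 : 1 < q) (n : ℕ) :
    padicValNat 2 (∏ i ∈ Finset.range n, (q ^ n - q ^ i)) =
      n * padicValNat 2 (q - 1) + padicValNat 2 n.factorial := by
  induction n with
  | zero => simp
  | succ n ih =>
    have hpow : q ^ (n + 1) - 1 ≠ 0 := by
      have := Nat.one_lt_pow n.add_one_ne_zero hq1
      omega
    have hprod := prod_range_pow_sub_pow_ne_zero hq1 n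
    have hqn : q ^ n ≠ 0 := pow_ne_zero _ (by omega)
    have hqn2 : ¬ 2 ∣ q ^ n := fun h ↦ by
      have := Nat.prime_two.dvd_of_dvd_pow h
      omega
    have hqn2 : ¬ 2 ∣ q ^ n := fun h ↦ by
      have := Nat.prime_two.dvd_of_dvd_pow h
      omega
    rw [prod_range_pow_sub_pow_succ, padicValNat.mul (mul_ne_zero hqn hprod) hpow,
      padicValNat.mul hqn hprod, padicValNat.eq_zero_of_not_dvd hqn2, ih,
      padicValNat_two_pow_sub_one hq hq1 n.succ_ne_zero, Nat.factorial_succ,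
      padicValNat.mul n.succ_ne_zero n.factorial_ne_zero]
    ring

theorem IsPrimitiveRoot.exists_injective_monoidHom {R : Type*} [CommRing R] {N : ℕ} {ζ : R}
    [NeZero N] (h : IsPrimitiveRoot ζ N) :
    ∃ χ : Multiplicative (ZMod N) →* Rˣ, Function.Injective χ := by
  have h' := h.isUnit_unit (NeZero.ne N)
  refine ⟨(Subgroup.zpowers _).subtype.comp
    (AddMonoidHom.toMultiplicativeLeft h'.zmodEquivZPowers.toAddMonoidHom), ?_⟩
  exact Subtype.val_injective.comp h'.zmodEquivZPowers.injective

/-- The monomial representation of the wreath product `C ≀ Perm ι` on `ι → K` attached to a linear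
character `χ` of `C`. -/
def monomialRep {ι C K : Type*} [Group C] [CommRing K] (χ : C →* Kˣ) :
    (ι → C) ⋊[mulAutArrow] Equiv.Perm ι →* Module.End K (ι → K) where
  toFun w := LinearMap.pi fun i ↦ (χ (w.left i) : K) • LinearMap.proj (w.right⁻¹ i)
  map_one' := by ext; simp
  map_mul' a b := by
    refine LinearMap.ext fun v ↦ funext fun i ↦ ?_
    simp only [SemidirectProduct.mul_left, SemidirectProduct.mul_right, mul_inv_rev, Pi.mul_apply,
      map_mul, Units.val_mul, LinearMap.pi_apply, LinearMap.smul_apply, LinearMap.proj_apply,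
      smul_eq_mul, Module.End.mul_apply, Equiv.Perm.mul_apply, mul_assoc]
    rfl

theorem monomialRep_apply {ι C K : Type*} [Group C] [CommRing K] (χ : C →* Kˣ)
    (w : (ι → C) ⋊[mulAutArrow] Equiv.Perm ι) (v : ι → K) (i : ι) :
    monomialRep χ w v i = χ (w.left i) * v (w.right⁻¹ i) := rfl

theorem monomialRep_injective {ι C K : Type*} [Group C] [CommRing K] [Nontrivial K]
    {χ : C →* Kˣ} (hχ : Function.Injective χ) :
    Function.Injective (monomialRep (ι := ι) χ) := by
  classical
  refine (injective_iff_map_eq_one _).2 fun w hw ↦ ?_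
  have key (v : ι → K) (i : ι) : χ (w.left i) * v (w.right⁻¹ i) = v i := by
    rw [← monomialRep_apply, hw]; rfl
  refine SemidirectProduct.ext (funext fun i ↦ hχ ?_) (inv_injective (Equiv.ext fun i ↦ ?_))
  · ext
    simpa using key 1 i
  · by_contra hi
    have := key (Pi.single i 1) i
    simp_all

theorem exists_injective_hom_GL {k G V : Type*} [Field k] [Group G] [AddCommGroup V] [Module k V]
    [FiniteDimensional k V] {ρ : G →* Module.End k V} (hρ : Function.Injective ρ) {d : ℕ}
    (hd : Module.finrank k V = d) :
    ∃ φ : G →* Matrix.GeneralLinearGroup (Fin d) k, Function.Injective φ := by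
  let b := Module.finBasisOfFinrankEq k V hd
  let f : G →* Matrix (Fin d) (Fin d) k := (LinearMap.toMatrixAlgEquiv b : _ →* _).comp ρ
  refine ⟨f.toHomUnits, fun x y h ↦ hρ ((LinearMap.toMatrixAlgEquiv b).injective ?_)⟩
  exact congrArg Units.val h

theorem exists_injective_hom_GL_restrictScalars {k K G : Type*} [Field k] [Field K] [Algebra k K]
    [FiniteDimensional k K] [Group G] {n : ℕ} {ρ : G →* Module.End K (Fin n → K)}
    (hρ : Function.Injective ρ) :
    ∃ φ : G →* Matrix.GeneralLinearGroup (Fin (n * Module.finrank k K)) k,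
      Function.Injective φ := by
  let r : Module.End K (Fin n → K) →* Module.End k (Fin n → K) :=
    { toFun := LinearMap.restrictScalars k, map_one' := rfl, map_mul' _ _ := rfl }
  refine exists_injective_hom_GL (k := k) (V := Fin n → K) (ρ := r.comp ρ)
    ((LinearMap.restrictScalars_injective k).comp hρ) ?_
  simp [Module.finrank_pi_fintype]

section

open Polynomial Module

theorem finrank_adjoin_le_of_pow_eq_neg_one {k V : Type*} [Field k] (hchar : ringChar k ≠ 2)
    [AddCommGroup V] [Module k V] [FiniteDimensional k V] [Nontrivial V] {t : ℕ}
    {ζ : AlgebraicClosure k} (hζ : IsPrimitiveRoot ζ (2 ^ (t + 1)))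
    {B : End k V} (hB : B ^ 2 ^ t = -1) :
    finrank k (IntermediateField.adjoin k {ζ}) ≤ finrank k V := by
  have hint : IsIntegral k B := Algebra.IsIntegral.isIntegral B
  obtain ⟨l, hl⟩ := IsAlgClosed.exists_aeval_eq_zero (AlgebraicClosure k) (minpoly k B)
    (minpoly.degree_pos hint).ne'
  have hdvd : minpoly k B ∣ X ^ 2 ^ t + 1 := minpoly.dvd _ _ (by simp [hB])
  have hl1 : l ^ 2 ^ t = -1 := by
    have := aeval_eq_zero_of_dvd_aeval_eq_zero hdvd hl
    simpa [add_eq_zero_iff_eq_neg] using this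
  have hlprim : IsPrimitiveRoot l (2 ^ (t + 1)) := by
    have hneg : (-1 : AlgebraicClosure k) ≠ 1 := Ring.neg_one_ne_one_of_char_ne_two (by
      rwa [← Algebra.ringChar_eq k (AlgebraicClosure k)])
    rw [← orderOf_eq_prime_pow (x := l) (p := 2) (n := t) (by rwa [hl1])
      (by rw [pow_succ, pow_mul, hl1]; simp)]
    exact IsPrimitiveRoot.orderOf l
  have hle : IntermediateField.adjoin k {ζ} ≤ IntermediateField.adjoin k {l} := by
    rw [IntermediateField.adjoin_simple_le_iff]
    obtain ⟨i, -, rfl⟩ := hlprim.eq_pow_of_pow_eq_one hζ.pow_eq_one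
    exact pow_mem (IntermediateField.mem_adjoin_simple_self k l) i
  have hlint : IsIntegral k l := Algebra.IsIntegral.isIntegral l
  have := IntermediateField.adjoin.finiteDimensional hlint
  calc finrank k (IntermediateField.adjoin k {ζ})
      ≤ finrank k (IntermediateField.adjoin k {l}) := IntermediateField.finrank_le_of_le_right hle
    _ = (minpoly k l).natDegree := IntermediateField.adjoin.finrank hlint
    _ ≤ (minpoly k B).natDegree := natDegree_le_of_dvd (minpoly.dvd _ _ hl) (minpoly.ne_zero hint)
    _ ≤ B.charpoly.natDegree :=
      natDegree_le_of_dvd (LinearMap.minpoly_dvd_charpoly B) B.charpoly_monic.ne_zero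
    _ = finrank k V := B.charpoly_natDegree

theorem iSupIndep.card_mul_le_finrank {k V ι : Type*} [Field k] [AddCommGroup V] [Module k V]
    [FiniteDimensional k V] [Fintype ι] {W : ι → Submodule k V} (hW : iSupIndep W) {e : ℕ}
    (he : ∀ i, e ≤ finrank k (W i)) : Fintype.card ι * e ≤ finrank k V := by
  classical
  calc Fintype.card ι * e = ∑ _i : ι, e := by simp
    _ ≤ ∑ i, finrank k (W i) := Finset.sum_le_sum fun i _ ↦ he i
    _ = finrank k (DirectSum ι fun i ↦ W i) := (finrank_directSum k _).symm
    _ ≤ finrank k V := LinearMap.finrank_le_finrank_of_injective hW.dfinsupp_lsum_injective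

theorem iSup_eigenspace_eq_top_of_sq_eq_one {k V : Type*} [Field k] (hchar : ringChar k ≠ 2)
    [AddCommGroup V] [Module k V] {f : End k V} (hf : f ^ 2 = 1) :
    ⨆ μ, f.eigenspace μ = ⊤ := by
  have h2 : (2 : k) ≠ 0 := Ring.two_ne_zero hchar
  have hff (v : V) : f (f v) = v := by simpa [pow_two] using LinearMap.congr_fun hf v
  refine eq_top_iff.2 fun v _ ↦ ?_
  have hv : v = (2 : k)⁻¹ • (v + f v) + (2 : k)⁻¹ • (v - f v) := by
    rw [← smul_add, add_add_sub_cancel, ← two_smul k, inv_smul_smul₀ h2]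
  rw [hv]
  refine add_mem (Submodule.smul_mem _ _ (Submodule.mem_iSup_of_mem 1 ?_))
    (Submodule.smul_mem _ _ (Submodule.mem_iSup_of_mem (-1) ?_)) <;>
  simp [hff, add_comm]

theorem mul_finrank_adjoin_le_finrank {k V ι : Type*} [Field k] (hchar : ringChar k ≠ 2)
    [AddCommGroup V] [Module k V] [FiniteDimensional k V] {t : ℕ}
    {ζ : AlgebraicClosure k} (hζ : IsPrimitiveRoot ζ (2 ^ (t + 1)))
    {b : ι → End k V} (hcomm : ∀ i j, Commute (b i) (b j)) (hb : ∀ i, b i ^ 2 ^ (t + 1) = 1)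
    (hinj : Function.Injective fun i ↦ b i ^ 2 ^ t) {n : ℕ} (hn : 2 ^ n ≤ Nat.card ι) :
    n * finrank k (IntermediateField.adjoin k {ζ}) ≤ finrank k V := by
  classical
  set f : ι → End k V := fun i ↦ b i ^ 2 ^ t with hf
  have hfsq (i : ι) : f i ^ 2 = 1 := by rw [hf, ← pow_mul, ← pow_succ, hb]
  have hfcomm (i j : ι) : Commute (f i) (f j) := (hcomm i j).pow_pow _ _
  let W : (ι → k) → Submodule k V := fun χ ↦ ⨅ i, (f i).eigenspace (χ i)
  have hWmem {χ : ι → k} {v : V} : v ∈ W χ ↔ ∀ i, f i v = χ i • v := by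
    simp [W]
  have hgen (i : ι) (μ : k) : (f i).eigenspace μ ≤ (f i).maxGenEigenspace μ :=
    ((f i).genEigenspace μ).monotone le_top
  have hind : iSupIndep W :=
    (End.independent_iInf_maxGenEigenspace_of_forall_mapsTo f fun i j φ ↦
      End.mapsTo_maxGenEigenspace_of_comm (hfcomm j i) φ).mono
      fun χ ↦ iInf_mono fun i ↦ hgen i _
  have htop : ⨆ χ, W χ = ⊤ := by
    have hss (i : ι) (μ : k) : (f i).maxGenEigenspace μ = (f i).eigenspace μ := by
      refine End.IsFinitelySemisimple.maxGenEigenspace_eq_eigenspace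
        (End.isFinitelySemisimple_iff_isSemisimple.2
        (End.isSemisimple_of_squarefree_aeval_eq_zero (p := X ^ 2 - 1) ?_ (by simp [hfsq]))) μ
      exact (X_pow_sub_one_separable_iff.2 (by exact_mod_cast Ring.two_ne_zero hchar)).squarefree
    have := End.iSup_iInf_maxGenEigenspace_eq_top_of_iSup_maxGenEigenspace_eq_top_of_commute f
      (fun i j _ ↦ hfcomm i j) fun i ↦ by
        simpa only [hss] using iSup_eigenspace_eq_top_of_sq_eq_one hchar (hfsq i)
    simpa only [hss] using this
  have hval {χ : ι → k} (hχ : W χ ≠ ⊥) (i : ι) : χ i = 1 ∨ χ i = -1 := by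
    obtain ⟨v, hv, hv0⟩ := Submodule.exists_mem_ne_zero_of_ne_bot hχ
    rw [hWmem] at hv
    have : (χ i ^ 2) • v = (1 : k) • v := by
      rw [one_smul, pow_two, mul_smul, ← hv i, ← map_smul, ← hv i]
      simpa [pow_two] using LinearMap.congr_fun (hfsq i) v
    simpa using smul_left_injective k hv0 this
  let S := {χ : ι → k // W χ ≠ ⊥ ∧ χ ≠ 1}
  have hindS : iSupIndep fun χ : S ↦ W χ.1 := hind.comp Subtype.val_injective
  have : Finite S := by
    have hfin := WellFoundedGT.finite_ne_bot_of_iSupIndep hindS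
    have : {χ : S | W χ.1 ≠ ⊥} = Set.univ := Set.eq_univ_of_forall fun χ ↦ χ.2.1
    exact Set.finite_univ_iff.1 (this ▸ hfin)
  have := Fintype.ofFinite S
  have hfin (χ : S) : finrank k (IntermediateField.adjoin k {ζ}) ≤ finrank k (W χ.1) := by
    obtain ⟨χ, hχ, hχ1⟩ := χ
    obtain ⟨i, hi⟩ := Function.ne_iff.1 hχ1
    have hi := (hval hχ i).resolve_left hi
    have hmaps : ∀ v ∈ W χ, b i v ∈ W χ := fun v hv ↦ hWmem.2 fun j ↦ by
      have hc : Commute (f j) (b i) := (hcomm j i).pow_left _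
      rw [← End.mul_apply, hc.eq, End.mul_apply, hWmem.1 hv j, map_smul]
    have := Submodule.nontrivial_iff_ne_bot.2 hχ
    refine finrank_adjoin_le_of_pow_eq_neg_one hchar (V := W χ) hζ (B := (b i).restrict hmaps) ?_
    rw [End.pow_restrict (2 ^ t) hmaps]
    ext v
    simpa [hi] using hWmem.1 v.2 i
  have hcard : n ≤ Fintype.card S := by
    let g : ι → S → Bool := fun i χ ↦ decide (χ.1 i = 1)
    have hg : Function.Injective g := fun i j hij ↦ hinj <| by
      refine LinearMap.ext fun v ↦ ?_
      have hv : v ∈ ⨆ χ, W χ := htop ▸ Submodule.mem_top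
      suffices (⨆ χ, W χ) ≤ LinearMap.eqLocus (f i) (f j) from this hv
      refine iSup_le fun χ w hw ↦ ?_
      rcases eq_or_ne (W χ) ⊥ with hb | hb
      · obtain rfl : w = 0 := by simpa [hb] using hw
        simp
      rw [LinearMap.mem_eqLocus, hWmem.1 hw, hWmem.1 hw]
      congr 1
      rcases eq_or_ne χ 1 with rfl | h1
      · rfl
      have := congrFun hij ⟨χ, hb, h1⟩
      simp only [g, decide_eq_decide] at this
      rcases hval hb i with h | h <;> rcases hval hb j with h' | h' <;> simp_all
    have := hn.trans (Nat.card_le_card_of_injective g hg)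
    rw [Nat.card_eq_fintype_card, Fintype.card_fun, Fintype.card_bool] at this
    exact (Nat.pow_le_pow_iff_right one_lt_two).1 this
  exact (Nat.mul_le_mul_right _ hcard).trans (hindS.card_mul_le_finrank hfin)

end

theorem exists_isPrimitiveRoot_two_pow_padicValNat (F : Type*) [Field F] [Fintype F] :
    ∃ ω : F, IsPrimitiveRoot ω (2 ^ padicValNat 2 (Fintype.card F - 1)) := by
  classical
  obtain ⟨g, hg⟩ := IsCyclic.exists_ofOrder_eq_natCard (α := Fˣ)
  rw [Nat.card_eq_fintype_card, Fintype.card_units] at hg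
  obtain ⟨m, hm⟩ := pow_padicValNat_dvd (p := 2) (n := Fintype.card F - 1)
  have hpos : 0 < orderOf g := orderOf_pos g
  have := (hg ▸ IsPrimitiveRoot.orderOf g).pow (hg ▸ hpos) (hm.trans (mul_comm _ _))
  exact ⟨_, IsPrimitiveRoot.coe_units_iff.2 this⟩

theorem factorization_card_GL {F : Type*} [Field F] [Fintype F] (h4 : Fintype.card F % 4 = 1)
    (n : ℕ) :
    (Nat.card (Matrix.GeneralLinearGroup (Fin n) F)).factorization 2 =
      n * padicValNat 2 (Fintype.card F - 1) + padicValNat 2 n.factorial := by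
  rw [Matrix.card_GL_field, Nat.factorization_def _ Nat.prime_two,
    Fin.prod_univ_eq_prod_range (fun i ↦ Fintype.card F ^ n - Fintype.card F ^ i) n,
    padicValNat_two_prod_range_pow_sub_pow h4 Fintype.one_lt_card]

theorem factorization_card_wreath (s n : ℕ) :
    (Nat.card ((Fin n → Multiplicative (ZMod (2 ^ s))) ⋊[mulAutArrow]
      Equiv.Perm (Fin n))).factorization 2 = n * s + padicValNat 2 n.factorial := by
  rw [Nat.factorization_def _ Nat.prime_two, SemidirectProduct.card, Nat.card_fun, Nat.card_perm,
    Nat.card_eq_fintype_card (α := Fin n), Fintype.card_fin,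
    Nat.card_congr Multiplicative.toAdd, Nat.card_zmod,
    padicValNat.mul (by positivity) n.factorial_ne_zero, ← pow_mul, padicValNat.prime_pow, mul_comm]

/-- If `G` embeds into `H` with the same `p`-part of the order, their Sylow subgroups agree. -/
theorem Sylow.nonempty_mulEquiv_of_injective {G H : Type*} [Group G] [Group H] [Finite H] {p : ℕ}
    [Fact p.Prime] {f : G →* H} (hf : Function.Injective f)
    (hcard : (Nat.card G).factorization p = (Nat.card H).factorization p)
    (P : Sylow p G) (Q : Sylow p H) : Nonempty (P ≃* Q) := by
  have : Finite G := Finite.of_injective f hf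
  let e : P ≃* (P : Subgroup G).map f := (P : Subgroup G).equivMapOfInjective f hf
  have he : Nat.card ((P : Subgroup G).map f) = p ^ (Nat.card H).factorization p := by
    rw [← Nat.card_congr e.toEquiv, P.card_eq_multiplicity, hcard]
  exact ⟨e.trans (Sylow.equiv (Sylow.ofCard _ he) Q)⟩

theorem mul_finrank_adjoin_le_of_injective {k : Type*} [Field k] (hchar : ringChar k ≠ 2)
    {t n d : ℕ} {ζ : AlgebraicClosure k} (hζ : IsPrimitiveRoot ζ (2 ^ (t + 1)))
    {φ : (Fin n → Multiplicative (ZMod (2 ^ (t + 1)))) →* Matrix.GeneralLinearGroup (Fin d) k}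
    (hφ : Function.Injective φ) :
    n * Module.finrank k (IntermediateField.adjoin k {ζ}) ≤ d := by
  let ψ : (Fin n → Multiplicative (ZMod (2 ^ (t + 1)))) →* Module.End k (Fin d → k) :=
    ((Matrix.toLinAlgEquiv' : Matrix (Fin d) (Fin d) k ≃ₐ[k] _) : _ →* _).comp
      ((Units.coeHom _).comp φ)
  have hψ : Function.Injective ψ :=
    Matrix.toLinAlgEquiv'.injective.comp (Units.val_injective.comp hφ)
  let g : Multiplicative (ZMod (2 ^ (t + 1))) := Multiplicative.ofAdd 1
  have hg : orderOf g = 2 ^ (t + 1) := by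
    rw [orderOf_ofAdd_eq_addOrderOf, ZMod.addOrderOf_one]
  let a : (Fin n → Bool) → Fin n → Multiplicative (ZMod (2 ^ (t + 1))) :=
    fun ε i ↦ if ε i then g else 1
  have hga : g ^ 2 ^ t ≠ 1 :=
    pow_ne_one_of_lt_orderOf (by positivity) (by
      rw [hg]; exact Nat.pow_lt_pow_right one_lt_two t.lt_succ_self)
  have ha (ε : Fin n → Bool) : a ε ^ 2 ^ (t + 1) = 1 := funext fun i ↦ by
    by_cases h : ε i <;> simp [a, h, orderOf_dvd_iff_pow_eq_one.1 hg.dvd]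
  have hinj : Function.Injective fun ε ↦ a ε ^ 2 ^ t := fun ε ε' h ↦ funext fun i ↦ by
    have := congrFun h i
    cases h1 : ε i <;> cases h2 : ε' i <;> simp [a, h1, h2, hga, hga.symm] at this ⊢
  simpa using mul_finrank_adjoin_le_finrank hchar (V := Fin d → k) hζ (b := fun ε ↦ ψ (a ε))
    (fun i j ↦ (Commute.all (a i) (a j)).map ψ) (fun ε ↦ by rw [← map_pow, ha, map_one])
    (fun ε ε' h ↦ hinj (hψ (by simpa using h))) (n := n) (by simp)

theorem stmt0 (p r q s : ℕ) (hp : p.Prime) (hodd : p ≠ 2) (hr : 1 ≤ r)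
    (hq : q = p ^ r) (hq4 : q % 4 = 1) (hs : s = padicValNat 2 (q - 1))
    (k : Type*) [Field k] (hchar : ringChar k ≠ 2)
    (ζ : AlgebraicClosure k) (hζ : IsPrimitiveRoot ζ (2 ^ s))
    (F : Type*) [Field F] [Fintype F] (hF : Fintype.card F = q)
    (n : ℕ) (hn : 1 ≤ n)
    (P : Sylow 2 (Matrix.GeneralLinearGroup (Fin n) F)) :
    minFaithfulDim k (P : Subgroup (Matrix.GeneralLinearGroup (Fin n) F)) =
      n * Module.finrank k (IntermediateField.adjoin k {ζ}) := by
  subst hF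
  have : Fact (Nat.Prime 2) := ⟨Nat.prime_two⟩
  obtain ⟨t, ht⟩ : ∃ t, s = t + 1 := Nat.exists_eq_add_one_of_ne_zero fun h0 ↦ by
    have h2 : 2 ∣ Fintype.card F - 1 := by omega
    have h1 : 1 < Fintype.card F := Fintype.one_lt_card
    have := one_le_padicValNat_of_dvd (by omega) h2
    omega
  let W := (Fin n → Multiplicative (ZMod (2 ^ s))) ⋊[mulAutArrow] Equiv.Perm (Fin n)
  obtain ⟨ω, hω⟩ := exists_isPrimitiveRoot_two_pow_padicValNat F
  rw [← hs] at hω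
  obtain ⟨χ, hχ⟩ := hω.exists_injective_monoidHom
  obtain ⟨f, hf⟩ := exists_injective_hom_GL (k := F) (V := Fin n → F)
    (monomialRep_injective (ι := Fin n) hχ) (Module.finrank_fin_fun F)
  have hA : IsPGroup 2 (SemidirectProduct.inl : _ →* W).range := by
    refine IsPGroup.of_card (n := s * n) ?_
    rw [← Nat.card_congr (MonoidHom.ofInjective SemidirectProduct.inl_injective).toEquiv,
      Nat.card_fun, Nat.card_congr Multiplicative.toAdd, Nat.card_zmod, ← pow_mul]
    simp
  obtain ⟨Q, hQ⟩ := hA.exists_le_sylow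
  obtain ⟨e⟩ := Sylow.nonempty_mulEquiv_of_injective hf
    (by rw [factorization_card_wreath, factorization_card_GL hq4, ← hs]) Q P
  refine IsLeast.csInf_eq ⟨?_, ?_⟩
  · have hζint : IsIntegral k ζ := Algebra.IsIntegral.isIntegral ζ
    have := IntermediateField.adjoin.finiteDimensional hζint
    have hgen : IsPrimitiveRoot (IntermediateField.AdjoinSimple.gen k ζ) (2 ^ s) :=
      IsPrimitiveRoot.of_map_of_injective
        (f := algebraMap (IntermediateField.adjoin k {ζ}) (AlgebraicClosure k))
        (by simpa using hζ) (FaithfulSMul.algebraMap_injective _ _)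
    obtain ⟨η, hη⟩ := hgen.exists_injective_monoidHom
    obtain ⟨φ, hφ⟩ := exists_injective_hom_GL_restrictScalars (k := k)
      (monomialRep_injective (ι := Fin n) hη)
    exact ⟨φ.comp ((Q : Subgroup W).subtype.comp e.symm.toMonoidHom),
      hφ.comp (Subtype.val_injective.comp e.symm.injective)⟩
  · rintro d ⟨φ, hφ⟩
    subst ht
    let i : (Fin n → Multiplicative (ZMod (2 ^ (t + 1)))) →* Q :=
      SemidirectProduct.inl.codRestrict (Q : Subgroup W) fun x ↦ hQ ⟨x, rfl⟩
    have hi : Function.Injective i := fun x y h ↦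
      SemidirectProduct.inl_injective (congrArg Subtype.val h)
    exact mul_finrank_adjoin_le_of_injective hchar hζ (φ := φ.comp (e.toMonoidHom.comp i))
      (hφ.comp (e.injective.comp hi))
end

section
/- Let p be an odd prime, q = p^r with q ≡ 3 (mod 4), and s = v₂(q+1)+1. Let k be a field of characteristic ≠ 2 and let ε be a primitive 2^s-th root of unity in a fixed algebraic closure of k. Then for every m ≥ 1 and every Sylow 2-subgroup P of GL_{2m}(F_q), the minimal faithful representation dimension of P over k equals 2m·[k(ε−ε⁻¹):k]. -/
open Polynomial

/-- The integral polynomial expressing `x ^ N + x⁻¹ ^ N`, `N = 2 ^ (n + 1)`, through `x - x⁻¹`. -/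
noncomputable def tracePoly (R : Type*) [CommRing R] : ℕ → R[X]
  | 0 => X ^ 2 + 2
  | n + 1 => tracePoly R n ^ 2 - 2

theorem aeval_tracePoly {R A : Type*} [CommRing R] [Ring A] [Algebra R A] {x y : A}
    (hxy : x * y = 1) (hyx : y * x = 1) (n : ℕ) :
    aeval (x - y) (tracePoly R n) = x ^ 2 ^ (n + 1) + y ^ 2 ^ (n + 1) := by
  induction n with
  | zero =>
    simp only [tracePoly, map_add, map_pow, aeval_X, map_ofNat, zero_add, pow_one]
    rw [sq, sub_mul, mul_sub, mul_sub, hxy, hyx, sq, sq, ← one_add_one_eq_two]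
    abel
  | succ n ih =>
    have hc : Commute x y := hxy.trans hyx.symm
    have h1 : x ^ 2 ^ (n + 1) * y ^ 2 ^ (n + 1) = 1 := by rw [← hc.mul_pow, hxy, one_pow]
    have h2 : y ^ 2 ^ (n + 1) * x ^ 2 ^ (n + 1) = 1 := by rw [← hc.symm.mul_pow, hyx, one_pow]
    simp only [tracePoly, map_sub, map_pow, map_ofNat, ih]
    rw [pow_succ 2 (n + 1), pow_mul, pow_mul, sq, sq, sq, add_mul, mul_add, mul_add, h1, h2,
      ← one_add_one_eq_two (R := A)]
    abel

theorem aeval_tracePoly_eq_zero_iff {R A : Type*} [CommRing R] [Ring A] [Algebra R A] {x y : A}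
    (hxy : x * y = 1) (hyx : y * x = 1) (n : ℕ) :
    aeval (x - y) (tracePoly R n) = 0 ↔ x ^ 2 ^ (n + 2) = -1 := by
  have hc : Commute x y := hxy.trans hyx.symm
  have h1 : x ^ 2 ^ (n + 1) * y ^ 2 ^ (n + 1) = 1 := by rw [← hc.mul_pow, hxy, one_pow]
  have h2 : y ^ 2 ^ (n + 1) * x ^ 2 ^ (n + 1) = 1 := by rw [← hc.symm.mul_pow, hyx, one_pow]
  rw [aeval_tracePoly hxy hyx, pow_succ 2 (n + 1), pow_mul, sq]
  constructor
  · intro h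
    rw [add_eq_zero_iff_eq_neg] at h
    nth_rw 2 [h]
    rw [mul_neg, h1]
  · intro h
    have := congrArg (y ^ 2 ^ (n + 1) * ·) h
    simp only [← mul_assoc, h2, one_mul, mul_neg, mul_one] at this
    rw [this, neg_add_cancel]

/-- The homomorphism out of `ℤˣ` defined by an involution. -/
def involutionHom {M : Type*} [Monoid M] (y : M) (hy : y * y = 1) : ℤˣ →* M where
  toFun u := if u = 1 then 1 else y
  map_one' := by simp
  map_mul' u v := by
    rcases Int.units_eq_one_or u with rfl | rfl <;> rcases Int.units_eq_one_or v with rfl | rfl <;>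
      simp [hy]

@[simp] theorem involutionHom_neg_one {M : Type*} [Monoid M] (y : M) (hy : y * y = 1) :
    involutionHom y hy (-1) = y := by simp [involutionHom]

theorem semidihedralUnit_mul_self (n : ℕ) :
    ((2 ^ (n + 2) - 1 : ZMod (2 ^ (n + 3)))) * (2 ^ (n + 2) - 1) = 1 := by
  have h : (2 : ZMod (2 ^ (n + 3))) ^ (n + 3) = 0 := by
    exact_mod_cast ZMod.natCast_self (2 ^ (n + 3))
  have e : ((2 ^ (n + 2) - 1 : ZMod (2 ^ (n + 3)))) * (2 ^ (n + 2) - 1) =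
    2 ^ (n + 3) * (2 ^ (n + 1) - 1) + 1 := by ring
  rw [e, h, zero_mul, zero_add]

/-- The action of `ℤˣ` on a cyclic group of order `2 ^ (n + 3)` in which `-1` raises to the power
`2 ^ (n + 2) - 1`. -/
def semidihedralAction (n : ℕ) : ℤˣ →* MulAut (Multiplicative (ZMod (2 ^ (n + 3)))) :=
  (MulAutMultiplicative _).symm.toMonoidHom.comp <| AddAut.mulLeft.comp <|
    involutionHom (⟨2 ^ (n + 2) - 1, 2 ^ (n + 2) - 1, semidihedralUnit_mul_self n,
      semidihedralUnit_mul_self n⟩ : (ZMod (2 ^ (n + 3)))ˣ)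
      (Units.ext (semidihedralUnit_mul_self n))

theorem semidihedralAction_neg_one (n : ℕ) (i : ZMod (2 ^ (n + 3))) :
    semidihedralAction n (-1) (.ofAdd i) = .ofAdd ((2 ^ (n + 2) - 1) * i) := by
  simp [semidihedralAction]
  rfl

/-- The semidihedral group of order `2 ^ (n + 4)`. -/
abbrev Semidihedral (n : ℕ) : Type :=
  Multiplicative (ZMod (2 ^ (n + 3))) ⋊[semidihedralAction n] ℤˣ

namespace Semidihedral

/-- The rotation generating the cyclic subgroup of index two. -/
def rot (n : ℕ) : Semidihedral n := SemidirectProduct.inl (.ofAdd 1)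

/-- A noncentral involution. -/
def refl (n : ℕ) : Semidihedral n := SemidirectProduct.inr (-1)

theorem natCard (n : ℕ) : Nat.card (Semidihedral n) = 2 ^ (n + 4) := by
  rw [SemidirectProduct.card]
  simp [pow_succ]

theorem ofAdd_one_pow (n j : ℕ) :
    (Multiplicative.ofAdd (1 : ZMod (2 ^ (n + 3)))) ^ j = .ofAdd (j : ZMod (2 ^ (n + 3))) := by
  rw [← ofAdd_nsmul]; simp

theorem rot_pow (n j : ℕ) :
    rot n ^ j = SemidirectProduct.inl (.ofAdd (j : ZMod (2 ^ (n + 3)))) := by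
  rw [rot, ← map_pow, ofAdd_one_pow]

theorem rot_pow_two_pow (n : ℕ) : rot n ^ 2 ^ (n + 3) = 1 := by
  rw [rot_pow, ZMod.natCast_self]; rfl

theorem rot_pow_half_ne_one (n : ℕ) : rot n ^ 2 ^ (n + 2) ≠ 1 := by
  rw [rot_pow]
  intro h
  have h1 : ((2 ^ (n + 2) : ℕ) : ZMod (2 ^ (n + 3))) = 0 := by
    have := SemidirectProduct.inl_injective (h.trans (map_one _).symm)
    exact this
  rw [ZMod.natCast_eq_zero_iff, Nat.pow_dvd_pow_iff_le_right (by norm_num)] at h1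
  omega

theorem refl_mul_self (n : ℕ) : refl n * refl n = 1 := by
  rw [refl, ← map_mul]; simp

theorem refl_mul_rot (n : ℕ) : refl n * rot n = rot n ^ (2 ^ (n + 2) - 1) * refl n := by
  have h : refl n * rot n = SemidirectProduct.inl (semidihedralAction n (-1) (.ofAdd 1)) *
    SemidirectProduct.inr (-1) := by
    rw [SemidirectProduct.inl_aut, map_inv, inv_mul_cancel_right]; rfl
  rw [h, semidihedralAction_neg_one, rot_pow, Nat.cast_sub Nat.one_le_two_pow]
  simp [refl]

theorem exists_lift {M : Type*} [Group M] (n : ℕ) (x y : M) (hx : x ^ 2 ^ (n + 3) = 1)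
    (hx' : x ^ 2 ^ (n + 2) ≠ 1) (hy : y * y = 1) (hyx : y * x = x ^ (2 ^ (n + 2) - 1) * y)
    (hc : y * x ≠ x * y) : ∃ f : Semidihedral n →* M, Function.Injective f := by
  let f₀ : ZMod (2 ^ (n + 3)) →+ Additive M :=
    ZMod.lift _ ⟨zmultiplesHom (Additive M) (.ofMul x), by
      simp only [zmultiplesHom_apply, natCast_zsmul]; exact hx⟩
  let f₁ : Multiplicative (ZMod (2 ^ (n + 3))) →* M := AddMonoidHom.toMultiplicativeLeft f₀
  have hf₁ (j : ℕ) : f₁ (.ofAdd (j : ZMod (2 ^ (n + 3)))) = x ^ j := by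
    have h1 : f₁ (.ofAdd 1) = x := by
      have : f₀ ((1 : ℤ) : ZMod (2 ^ (n + 3))) = .ofMul x := by
        simp only [f₀, ZMod.lift_coe]; simp
      rw [Int.cast_one] at this
      exact congrArg Additive.toMul this
    rw [← ofAdd_one_pow, map_pow, h1]
  have hex (g : Multiplicative (ZMod (2 ^ (n + 3)))) :
      ∃ j : ℕ, g = .ofAdd (j : ZMod (2 ^ (n + 3))) :=
    ⟨ZMod.val g.toAdd, by rw [ZMod.natCast_zmod_val]; rfl⟩
  let f : Semidihedral n →* M := SemidirectProduct.lift f₁ (involutionHom y hy) (by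
    intro u
    rcases Int.units_eq_one_or u with rfl | rfl
    · ext; simp
    · refine MonoidHom.ext fun g => ?_
      obtain ⟨j, rfl⟩ := hex g
      have h : (2 ^ (n + 2) - 1 : ZMod (2 ^ (n + 3))) * j =
          (((2 ^ (n + 2) - 1) * j : ℕ) : ZMod (2 ^ (n + 3))) := by
        rw [Nat.cast_mul, Nat.cast_sub Nat.one_le_two_pow]; simp
      simp only [MonoidHom.comp_apply, MulEquiv.coe_toMonoidHom, semidihedralAction_neg_one,
        involutionHom_neg_one, MulAut.conj_apply, h, hf₁]
      rw [← conj_pow, hyx, mul_inv_cancel_right, pow_mul])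
  refine ⟨f, (injective_iff_map_eq_one f).2 ?_⟩
  rintro ⟨g, u⟩ hg
  obtain ⟨j, rfl⟩ := hex g
  have hg' : x ^ j * involutionHom y hy u = 1 := by rw [← hf₁]; exact hg
  rcases Int.units_eq_one_or u with rfl | rfl
  · rw [map_one, mul_one, ← orderOf_dvd_iff_pow_eq_one, orderOf_eq_prime_pow hx' hx] at hg'
    rw [(ZMod.natCast_eq_zero_iff _ _).2 hg']
    rfl
  · rw [involutionHom_neg_one] at hg'
    refine absurd ?_ hc
    rw [eq_inv_of_mul_eq_one_right hg']
    exact ((Commute.refl x).pow_left j).inv_left.eq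

end Semidihedral

theorem Semidihedral.exists_injective_end (n : ℕ) {R K : Type*} [CommRing R] [Field K] [Algebra R K]
    (h2 : (2 : K) ≠ 0) {t : K} (ht : aeval t (tracePoly R n) = 0) :
    ∃ f : Semidihedral n →* Module.End K (Fin 2 → K), Function.Injective f := by
  let A : Matrix (Fin 2) (Fin 2) K := !![0, 1; 1, t]
  let A' : Matrix (Fin 2) (Fin 2) K := !![-t, 1; 1, 0]
  let B : Matrix (Fin 2) (Fin 2) K := !![1, t; 0, -1]
  have hAA' : A * A' = 1 := by
    ext i j; fin_cases i <;> fin_cases j <;> simp [A, A', Matrix.mul_apply]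
  have hA'A : A' * A = 1 := by
    ext i j; fin_cases i <;> fin_cases j <;> simp [A, A', Matrix.mul_apply]
  have hBB : B * B = 1 := by
    ext i j; fin_cases i <;> fin_cases j <;> simp [B, Matrix.mul_apply]
  have hBA : B * A = -(A' * B) := by
    ext i j; fin_cases i <;> fin_cases j <;> simp [A, A', B, Matrix.mul_apply]
  have hne : (1 : Matrix (Fin 2) (Fin 2) K) ≠ -1 := by
    intro h
    have := congrFun (congrFun h 0) 0
    simp only [Matrix.one_apply_eq, Matrix.neg_apply] at this
    exact h2 (by linear_combination this)
  have hpow : A ^ 2 ^ (n + 2) = -1 := by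
    rw [← aeval_tracePoly_eq_zero_iff (R := R) hAA' hA'A]
    have : A - A' = algebraMap K (Matrix (Fin 2) (Fin 2) K) t := by
      ext i j; fin_cases i <;> fin_cases j <;> simp [A, A', Matrix.algebraMap_matrix_apply]
    rw [this, aeval_algebraMap_apply, ht, map_zero]
  obtain ⟨f, hf⟩ := Semidihedral.exists_lift n
    (⟨A, A', hAA', hA'A⟩ : (Matrix (Fin 2) (Fin 2) K)ˣ) ⟨B, B, hBB, hBB⟩
    (Units.ext <| by
      simp only [Units.val_pow_eq_pow_val, Units.val_one]
      rw [pow_succ 2 (n + 2), pow_mul, hpow, sq, neg_mul_neg, one_mul])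
    (fun h => hne <| by
      have := congrArg Units.val h
      simp only [Units.val_pow_eq_pow_val, Units.val_one] at this
      exact this.symm.trans hpow)
    (Units.ext hBB)
    (Units.ext <| by
      simp only [Units.val_pow_eq_pow_val, Units.val_mul]
      have : A ^ (2 ^ (n + 2) - 1) = -A' := by
        rw [← mul_one (A ^ _), ← hAA', ← mul_assoc, ← pow_succ,
          Nat.sub_add_cancel Nat.one_le_two_pow, hpow, neg_mul, one_mul]
      rw [this, hBA, neg_mul])
    (fun h => h2 <| by
      have h' : B * A = A * B := congrArg Units.val h
      have := congrFun (congrFun h' 1) 0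
      simp [A, B, Matrix.mul_apply] at this
      linear_combination -this)
  let e : Matrix (Fin 2) (Fin 2) K ≃ₐ[K] Module.End K (Fin 2 → K) := Matrix.toLinAlgEquiv'
  let g : Semidihedral n →* Matrix (Fin 2) (Fin 2) K := (Units.coeHom _).comp f
  exact ⟨e.toAlgHom.toRingHom.toMonoidHom.comp g,
    e.injective.comp (Units.val_injective.comp hf)⟩

/-- The wreath product of `H` with the symmetric group on `m` letters. -/
abbrev SymWreath (H : Type*) [Group H] (m : ℕ) : Type _ :=
  (Fin m → H) ⋊[(mulAutArrow : Equiv.Perm (Fin m) →* MulAut (Fin m → H))] Equiv.Perm (Fin m)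

/-- The representation of the wreath product induced by a representation of `H`. -/
def wreathEnd {H K V : Type*} [Group H] [Field K] [AddCommGroup V] [Module K V]
    (ρ : H →* Module.End K V) (m : ℕ) : SymWreath H m →* Module.End K (Fin m → V) where
  toFun g := LinearMap.pi fun i => ρ (g.left i) ∘ₗ LinearMap.proj (g.right⁻¹ i)
  map_one' := by ext; simp
  map_mul' g h := by
    refine LinearMap.ext fun v => funext fun i => ?_
    simp [mulAutArrow, MulDistribMulAction.toMulAut]
    rfl

theorem wreathEnd_injective {H K V : Type*} [Group H] [Field K] [AddCommGroup V] [Module K V]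
    [Nontrivial V] {ρ : H →* Module.End K V} (hρ : Function.Injective ρ) (m : ℕ) :
    Function.Injective (wreathEnd ρ m) := by
  refine (injective_iff_map_eq_one _).2 fun g hg => ?_
  have key (v : Fin m → V) (i : Fin m) : ρ (g.left i) (v (g.right⁻¹ i)) = v i :=
    congrFun (LinearMap.congr_fun hg v) i
  have hinj (a : H) (w : V) (h : ρ a w = 0) : w = 0 := by
    have : ρ a⁻¹ (ρ a w) = w := by rw [← Module.End.mul_apply, ← map_mul]; simp
    rw [← this, h, map_zero]
  have hr : g.right = 1 := by
    ext j
    obtain ⟨w, hw⟩ := exists_ne (0 : V)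
    by_contra hj
    have := key (Pi.single j w) (g.right j)
    rw [Equiv.Perm.inv_def, Equiv.symm_apply_apply, Pi.single_eq_same,
      Pi.single_eq_of_ne (fun h => hj (by rw [h]; rfl))] at this
    exact hw (hinj _ _ this)
  refine SemidirectProduct.ext (funext fun i => hρ (LinearMap.ext fun w => ?_)) hr
  have := key (fun _ => w) i
  simpa using this

theorem natCard_symWreath (H : Type*) [Group H] (m : ℕ) :
    Nat.card (SymWreath H m) = Nat.card H ^ m * m.factorial := by
  rw [SemidirectProduct.card, Nat.card_perm, Nat.card_fun]
  simp

theorem exists_injective_GL {k G V : Type*} [Field k] [Group G] [AddCommGroup V] [Module k V]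
    [FiniteDimensional k V] (f : G →* Module.End k V) (hf : Function.Injective f) :
    ∃ φ : G →* Matrix.GeneralLinearGroup (Fin (Module.finrank k V)) k, Function.Injective φ := by
  let e := LinearMap.toMatrixAlgEquiv (Module.finBasis k V)
  let f' : G →* Matrix (Fin (Module.finrank k V)) (Fin (Module.finrank k V)) k :=
    e.toAlgHom.toRingHom.toMonoidHom.comp f
  refine ⟨f'.toHomUnits, fun a b h => hf (e.injective ?_)⟩
  exact congrArg Units.val h

theorem exists_injective_end_restrictScalars {G V : Type*} (k : Type*) {K : Type*} [Field k]
    [Field K] [Algebra k K] [Group G] [AddCommGroup V] [Module k V] [Module K V]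
    [IsScalarTower k K V] (f : G →* Module.End K V) (hf : Function.Injective f) :
    ∃ φ : G →* Module.End k V, Function.Injective φ :=
  ⟨⟨⟨fun g => (f g).restrictScalars k, by ext; simp⟩, fun a b => by ext; simp⟩, fun a b h =>
    hf (LinearMap.restrictScalars_injective k h)⟩

theorem IsPGroup.exists_injective_sylow {p : ℕ} [Fact p.Prime] {Q G : Type*} [Group Q] [Group G]
    [Finite G] (hQ : IsPGroup p Q) (f : Q →* G) (hf : Function.Injective f) (P : Sylow p G) :
    ∃ φ : Q →* P, Function.Injective φ := by
  obtain ⟨P', hP'⟩ := (hQ.of_surjective _ f.rangeRestrict_surjective).exists_le_sylow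
  refine ⟨(P'.equiv P).toMonoidHom.comp
    ((Subgroup.inclusion hP').comp f.rangeRestrict), ?_⟩
  exact (P'.equiv P).injective.comp
    ((Subgroup.inclusion_injective hP').comp (f.rangeRestrict_injective_iff.2 hf))

theorem padicValNat_two_pow_sub_one_of_odd {q j : ℕ} (hq : q % 4 = 3) (hj : Odd j) :
    padicValNat 2 (q ^ j - 1) = 1 := by
  have h : q ^ j % 4 = 3 := by
    obtain ⟨l, rfl⟩ := hj
    rw [pow_succ, pow_mul, Nat.mul_mod, Nat.pow_mod, Nat.pow_mod q, hq]
    simp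
  have h1 : q ^ j - 1 = 2 * (2 * (q ^ j / 4) + 1) := by omega
  rw [h1, padicValNat.mul (by norm_num) (by omega), padicValNat.self (by norm_num),
    padicValNat.eq_zero_of_not_dvd (by omega)]

theorem padicValNat_two_pow_two_mul_sub_one {q l : ℕ} (hq : q % 4 = 3) (hl : l ≠ 0) :
    padicValNat 2 (q ^ (2 * l) - 1) = padicValNat 2 (q + 1) + 1 + padicValNat 2 l := by
  have h := padicValNat.pow_two_sub_pow (x := q) (y := 1) (by omega) (by omega) (by omega)
    (n := 2 * l) (by omega) (even_two_mul l)
  have h1 := padicValNat_two_pow_sub_one_of_odd hq odd_one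
  rw [pow_one] at h1
  rw [one_pow, h1, padicValNat.mul (by norm_num) hl, padicValNat.self (by norm_num)] at h
  omega

theorem padicValNat_two_prod_pow_sub_one {q : ℕ} (hq : q % 4 = 3) (m : ℕ) :
    padicValNat 2 (∏ j ∈ Finset.range (2 * m), (q ^ (j + 1) - 1)) =
      (padicValNat 2 (q + 1) + 2) * m + padicValNat 2 m.factorial := by
  have hpos (j : ℕ) : q ^ (j + 1) - 1 ≠ 0 := by
    have := Nat.one_lt_pow (n := j + 1) (by omega) (show 1 < q by omega)
    omega
  induction m with
  | zero => simp
  | succ m ih =>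
    rw [show 2 * (m + 1) = 2 * m + 1 + 1 by ring, Finset.prod_range_succ, Finset.prod_range_succ,
      padicValNat.mul (mul_ne_zero (Finset.prod_ne_zero_iff.2 fun j _ => hpos j) (hpos _)) (hpos _),
      padicValNat.mul (Finset.prod_ne_zero_iff.2 fun j _ => hpos j) (hpos _), ih,
      padicValNat_two_pow_sub_one_of_odd hq ⟨m, rfl⟩,
      show 2 * m + 1 + 1 = 2 * (m + 1) by ring,
      padicValNat_two_pow_two_mul_sub_one hq (Nat.succ_ne_zero m), Nat.factorial_succ,
      padicValNat.mul (Nat.succ_ne_zero m) m.factorial_ne_zero]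
    ring

theorem padicValNat_two_card_GL {F : Type*} [Field F] [Fintype F] (hq : Fintype.card F % 4 = 3)
    (m : ℕ) : padicValNat 2 (Nat.card (Matrix.GeneralLinearGroup (Fin (2 * m)) F)) =
      (padicValNat 2 (Fintype.card F + 1) + 2) * m + padicValNat 2 m.factorial := by
  set q := Fintype.card F
  rw [Matrix.card_GL_field, ← padicValNat_two_prod_pow_sub_one hq,
    Fin.prod_univ_eq_prod_range (fun i => q ^ (2 * m) - q ^ i) (2 * m),
    ← Finset.prod_range_reflect (fun j => q ^ (j + 1) - 1)]
  have : ∏ i ∈ Finset.range (2 * m), (q ^ (2 * m) - q ^ i) = (∏ i ∈ Finset.range (2 * m), q ^ i) *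
      ∏ i ∈ Finset.range (2 * m), (q ^ (2 * m - 1 - i + 1) - 1) := by
    rw [← Finset.prod_mul_distrib]
    refine Finset.prod_congr rfl fun i hi => ?_
    rw [Finset.mem_range] at hi
    rw [Nat.mul_sub, mul_one, ← pow_add]
    congr 2
    omega
  have hpos (j : ℕ) : q ^ (j + 1) - 1 ≠ 0 := by
    have := Nat.one_lt_pow (n := j + 1) (by omega) (show 1 < q by omega)
    omega
  have hq0 (i : ℕ) : q ^ i ≠ 0 := pow_ne_zero _ (by omega)
  rw [this, padicValNat.mul (Finset.prod_ne_zero_iff.2 fun j _ => hq0 j)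
    (Finset.prod_ne_zero_iff.2 fun j _ => hpos _), padicValNat.eq_zero_of_not_dvd, zero_add]
  rw [Finset.prod_pow_eq_pow_sum]
  intro h
  have := Nat.prime_two.dvd_of_dvd_pow h
  omega

theorem natCard_sylow_symWreath_eq {F : Type*} [Field F] [Fintype F]
    (hq : Fintype.card F % 4 = 3) {n : ℕ} (hn : padicValNat 2 (Fintype.card F + 1) = n + 2) (m : ℕ)
    (Q : Sylow 2 (SymWreath (Semidihedral n) m))
    (P : Sylow 2 (Matrix.GeneralLinearGroup (Fin (2 * m)) F)) : Nat.card Q = Nat.card P := by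
  have hH := Semidihedral.natCard n
  have : Finite (Semidihedral n) := Nat.finite_of_card_ne_zero (by rw [hH]; positivity)
  have : Finite (SymWreath (Semidihedral n) m) :=
    Nat.finite_of_card_ne_zero (by rw [natCard_symWreath, hH]; positivity)
  rw [Q.card_eq_multiplicity, P.card_eq_multiplicity, Nat.factorization_def _ Nat.prime_two,
    Nat.factorization_def _ Nat.prime_two, padicValNat_two_card_GL hq, natCard_symWreath, hH, hn,
    padicValNat.mul (by positivity) (by positivity), ← pow_mul, padicValNat.prime_pow]

theorem FiniteField.mem_range_algebraMap_of_pow_card_eq {F L : Type*} [Field F] [Fintype F]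
    [Field L] [Algebra F L] {x : L} (hx : x ^ Fintype.card F = x) :
    ∃ a : F, algebraMap F L a = x := by
  have hne : (X ^ Fintype.card F - X : F[X]) ≠ 0 :=
    FiniteField.X_pow_card_sub_X_ne_zero F Fintype.one_lt_card
  have hcard : (X ^ Fintype.card F - X : F[X]).roots.card =
      (X ^ Fintype.card F - X : F[X]).natDegree := by
    rw [FiniteField.roots_X_pow_card_sub_X,
      FiniteField.X_pow_card_sub_X_natDegree_eq F Fintype.one_lt_card]
    rfl
  have hsplit : (X ^ Fintype.card F - X : F[X]).Splits := splits_iff_card_roots.2 hcard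
  have hroot : aeval x (X ^ Fintype.card F - X : F[X]) = 0 := by simp [hx]
  exact hsplit.mem_range_of_isRoot hne (by simpa using hroot)

theorem exists_aeval_tracePoly_eq_zero {F : Type*} [Field F] [Fintype F]
    {n : ℕ} (hn : padicValNat 2 (Fintype.card F + 1) = n + 2) :
    ∃ t : F, aeval t (tracePoly F n) = 0 := by
  obtain ⟨x, hx⟩ := IsAlgClosed.exists_pow_nat_eq (-1 : AlgebraicClosure F)
    (n := 2 ^ (n + 2)) (by positivity)
  have hx0 : x ≠ 0 := by
    rintro rfl
    rw [zero_pow (by positivity)] at hx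
    simp at hx
  obtain ⟨l, hl⟩ : 2 ^ (n + 2) ∣ Fintype.card F + 1 := hn ▸ pow_padicValNat_dvd
  have hlodd : Odd l := by
    rw [← Nat.not_even_iff_odd]
    rintro ⟨j, rfl⟩
    have : 2 ^ (n + 3) ∣ Fintype.card F + 1 := ⟨j, by rw [hl]; ring⟩
    rw [padicValNat_dvd_iff_le (by omega), hn] at this
    omega
  have hxq : x ^ Fintype.card F = -x⁻¹ := by
    rw [← mul_left_inj' hx0, ← pow_succ, hl, pow_mul, hx, hlodd.neg_one_pow, neg_mul,
      inv_mul_cancel₀ hx0]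
  have hfix : (x - x⁻¹) ^ Fintype.card F = x - x⁻¹ := by
    have := map_sub (FiniteField.frobeniusAlgHom F (AlgebraicClosure F)) x x⁻¹
    simp only [FiniteField.coe_frobeniusAlgHom, inv_pow, hxq] at this
    rw [this, inv_neg, inv_inv]
    ring
  obtain ⟨t, ht⟩ := FiniteField.mem_range_algebraMap_of_pow_card_eq hfix
  refine ⟨t, (algebraMap F (AlgebraicClosure F)).injective ?_⟩
  rw [← aeval_algebraMap_apply, ht, map_zero,
    aeval_tracePoly_eq_zero_iff (mul_inv_cancel₀ hx0) (inv_mul_cancel₀ hx0), hx]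

theorem pow_two_pow_eq_one_of_eq_neg_one {R : Type*} [Ring R] {x : R} {n : ℕ}
    (h : x ^ 2 ^ n = -1) : x ^ 2 ^ (n + 1) = 1 := by
  rw [pow_succ, pow_mul, h, sq, neg_mul_neg, one_mul]

theorem isPrimitiveRoot_iff_pow_eq_neg_one {K : Type*} [Field K] (h2 : (2 : K) ≠ 0) {x : K} {n : ℕ} :
    IsPrimitiveRoot x (2 ^ (n + 1)) ↔ x ^ 2 ^ n = -1 := by
  constructor
  · intro h
    have h1 := h.pow_eq_one
    rw [pow_succ, pow_mul, sq_eq_one_iff] at h1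
    refine h1.resolve_left (h.pow_ne_one_of_pos_of_lt (by positivity) ?_)
    exact Nat.pow_lt_pow_right (by norm_num) (by omega)
  · intro h
    rw [IsPrimitiveRoot.iff_orderOf]
    refine orderOf_eq_prime_pow (fun h1 => h2 ?_) (pow_two_pow_eq_one_of_eq_neg_one h)
    rw [h] at h1
    linear_combination -h1

theorem adjoin_sub_inv_le {k K : Type*} [Field k] [Field K] [Algebra k K] (h2 : (2 : K) ≠ 0) {n : ℕ}
    {x y : K} (hx : x ^ 2 ^ (n + 2) = -1) (hy : y ^ 2 ^ (n + 2) = -1) :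
    IntermediateField.adjoin k {y - y⁻¹} ≤ IntermediateField.adjoin k {x - x⁻¹} := by
  have hx0 : x ≠ 0 := by
    rintro rfl
    rw [zero_pow (by positivity)] at hx
    simp at hx
  obtain ⟨i, -, rfl⟩ := ((isPrimitiveRoot_iff_pow_eq_neg_one h2).2 hx).eq_pow_of_pow_eq_one
    (pow_two_pow_eq_one_of_eq_neg_one hy)
  have hi : Odd i := by
    rw [← Nat.not_even_iff_odd]
    intro hi
    rw [← pow_mul, mul_comm, pow_mul, hx, hi.neg_one_pow] at hy
    exact h2 (by linear_combination hy)
  set t := x - x⁻¹ with ht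
  have htmem : t ∈ IntermediateField.adjoin k {t} := IntermediateField.mem_adjoin_simple_self k t
  have key (j : ℕ) : x ^ j + (-x⁻¹) ^ j ∈ IntermediateField.adjoin k {t} := by
    induction j using Nat.strong_induction_on with
    | _ j ih =>
      match j with
      | 0 => simpa using add_mem (one_mem _) (one_mem _)
      | 1 => simpa [← sub_eq_add_neg] using htmem
      | j + 2 =>
        have : x ^ (j + 2) + (-x⁻¹) ^ (j + 2) =
            t * (x ^ (j + 1) + (-x⁻¹) ^ (j + 1)) + (x ^ j + (-x⁻¹) ^ j) := by
          have h1 : x * x⁻¹ = 1 := mul_inv_cancel₀ hx0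
          rw [ht]
          linear_combination (x ^ j + (-x⁻¹) ^ j) * h1
        rw [this]
        exact add_mem (mul_mem htmem (ih _ (by omega))) (ih _ (by omega))
  rw [IntermediateField.adjoin_simple_le_iff]
  have := key i
  rwa [hi.neg_pow, inv_pow, ← sub_eq_add_neg] at this

theorem finrank_adjoin_le_of_aeval_tracePoly {k V : Type*} [Field k] [AddCommGroup V] [Module k V]
    [FiniteDimensional k V] [Nontrivial V] (h2 : (2 : k) ≠ 0) {n : ℕ} {ε : AlgebraicClosure k}
    (hε : ε ^ 2 ^ (n + 2) = -1) {T : Module.End k V} (hT : aeval T (tracePoly k n) = 0) :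
    Module.finrank k (IntermediateField.adjoin k {ε - ε⁻¹}) ≤ Module.finrank k V := by
  have h2' : (2 : AlgebraicClosure k) ≠ 0 := by
    rw [← map_ofNat (algebraMap k (AlgebraicClosure k)) 2]
    exact (_root_.map_ne_zero _).2 h2
  have hTint : IsIntegral k T := Algebra.IsIntegral.isIntegral T
  obtain ⟨τ, hτ⟩ := IsAlgClosed.exists_aeval_eq_zero (AlgebraicClosure k) (minpoly k T)
    (minpoly.degree_pos hTint).ne'
  obtain ⟨x, hx⟩ := IsAlgClosed.exists_aeval_eq_zero (AlgebraicClosure k)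
    (X ^ 2 - C τ * X - 1 : (AlgebraicClosure k)[X]) (by
      have : (X ^ 2 - C τ * X - 1 : (AlgebraicClosure k)[X]).degree = 2 := by compute_degree!
      rw [this]; norm_num)
  simp only [map_sub, map_mul, map_pow, aeval_X, aeval_C, map_one, Algebra.algebraMap_self,
    RingHom.id_apply] at hx
  have hx0 : x ≠ 0 := by rintro rfl; simp at hx
  have hτx : τ = x - x⁻¹ := by
    field_simp
    linear_combination -hx
  have hx' : x ^ 2 ^ (n + 2) = -1 := by
    rw [← aeval_tracePoly_eq_zero_iff (R := k) (mul_inv_cancel₀ hx0) (inv_mul_cancel₀ hx0), ← hτx]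
    obtain ⟨g, hg⟩ := minpoly.dvd k T hT
    rw [hg, map_mul, hτ, zero_mul]
  have hτint : IsIntegral k τ := Algebra.IsIntegral.isIntegral τ
  have : FiniteDimensional k (IntermediateField.adjoin k {τ}) :=
    IntermediateField.adjoin.finiteDimensional hτint
  calc Module.finrank k (IntermediateField.adjoin k {ε - ε⁻¹})
      ≤ Module.finrank k (IntermediateField.adjoin k {τ}) :=
        IntermediateField.finrank_le_of_le_right (hτx ▸ adjoin_sub_inv_le h2' hx' hε)
    _ = (minpoly k τ).natDegree := IntermediateField.adjoin.finrank hτint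
    _ ≤ (minpoly k T).natDegree :=
        natDegree_le_of_dvd (minpoly.dvd k τ hτ) (minpoly.ne_zero hTint)
    _ ≤ T.charpoly.natDegree :=
        natDegree_le_of_dvd (LinearMap.minpoly_dvd_charpoly T) T.charpoly_monic.ne_zero
    _ = Module.finrank k V := LinearMap.charpoly_natDegree T

theorem aeval_restrict_coe {k V : Type*} [Field k] [AddCommGroup V] [Module k V]
    {U : Submodule k V} {T : Module.End k V} (hU : ∀ u ∈ U, T u ∈ U) (p : k[X]) (u : U) :
    (aeval (T.restrict hU) p u : V) = aeval T p u := by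
  induction p using Polynomial.induction_on' generalizing u with
  | add p q hp hq => simp [hp, hq]
  | monomial j a =>
    have h : ((((T.restrict hU) ^ j) u : U) : V) = (T ^ j) u := by
      induction j generalizing u with
      | zero => simp
      | succ j ih => rw [pow_succ, pow_succ, Module.End.mul_apply, Module.End.mul_apply, ih]; rfl
    simp [aeval_monomial, h]

theorem finrank_adjoin_le_finrank_ker {k V : Type*} [Field k] [AddCommGroup V] [Module k V]
    [FiniteDimensional k V] [Nontrivial V] (h2 : (2 : k) ≠ 0) {n : ℕ} {ε : AlgebraicClosure k}
    (hε : ε ^ 2 ^ (n + 2) = -1) {x x' y : Module.End k V} (hxx' : x * x' = 1) (hx'x : x' * x = 1)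
    (hyy : y * y = 1) (hyx : y * x = -(x' * y)) (hx : x ^ 2 ^ (n + 2) = -1) :
    Module.finrank k (IntermediateField.adjoin k {ε - ε⁻¹}) ≤
      Module.finrank k (LinearMap.ker (y - 1)) := by
  have hyx' : y * x' = -(x * y) := by
    have : x * (y * x) * x' = x * (-(x' * y)) * x' := by rw [hyx]
    rw [mul_assoc, mul_assoc, hxx', mul_one, mul_neg, ← mul_assoc x, hxx', one_mul] at this
    rw [this, neg_mul, neg_neg]
  have hTy : y * (x - x') = (x - x') * y := by
    rw [mul_sub, sub_mul, hyx, hyx']; abel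
  have hZy : y * (x + x') = -((x + x') * y) := by
    rw [mul_add, add_mul, hyx, hyx']; abel
  have hZ (w : V) (hw : (x + x') w = 0) : w = 0 := by
    have h1 : (x ^ 2) w = -w := by
      have : x ((x + x') w) = (x ^ 2) w + w := by
        rw [← Module.End.mul_apply, mul_add, hxx', sq]; rfl
      rw [hw, map_zero] at this
      exact eq_neg_of_add_eq_zero_left this.symm
    have h4 : (x ^ 4) w = w := by
      rw [show 4 = 2 + 2 from rfl, pow_add, Module.End.mul_apply, h1, map_neg, h1, neg_neg]
    have h5 : ∀ j : ℕ, ((x ^ 4) ^ j) w = w := by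
      intro j
      induction j with
      | zero => simp
      | succ j ih => rw [pow_succ, Module.End.mul_apply, h4, ih]
    have h6 := h5 (2 ^ n)
    rw [← pow_mul, show 4 * 2 ^ n = 2 ^ (n + 2) by ring, hx] at h6
    have h7 : (2 : k) • w = 0 := by
      rw [two_smul]
      nth_rw 1 [← h6]
      simp
    exact (smul_eq_zero.1 h7).resolve_left h2
  have hmem (w : V) : w ∈ LinearMap.ker (y - 1) ↔ y w = w := by
    rw [LinearMap.mem_ker, LinearMap.sub_apply, Module.End.one_apply, sub_eq_zero]
  have hyy' (w : V) : y (y w) = w := by rw [← Module.End.mul_apply, hyy]; rfl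
  have hnt : Nontrivial (LinearMap.ker (y - 1)) := by
    rw [Submodule.nontrivial_iff_ne_bot, Submodule.ne_bot_iff]
    obtain ⟨w, hw⟩ := exists_ne (0 : V)
    by_cases h : y w + w = 0
    · refine ⟨(x + x') w, ?_, fun h0 => hw (hZ w h0)⟩
      rw [hmem, ← Module.End.mul_apply, hZy, LinearMap.neg_apply, Module.End.mul_apply,
        eq_neg_of_add_eq_zero_left h, map_neg, neg_neg]
    · exact ⟨y w + w, by rw [hmem, map_add, hyy', add_comm], h⟩
  have hU : ∀ u ∈ LinearMap.ker (y - 1), (x - x') u ∈ LinearMap.ker (y - 1) := by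
    intro u hu
    rw [hmem] at hu ⊢
    rw [← Module.End.mul_apply, hTy, Module.End.mul_apply, hu]
  refine finrank_adjoin_le_of_aeval_tracePoly h2 hε (T := (x - x').restrict hU) ?_
  ext u
  rw [aeval_restrict_coe, (aeval_tracePoly_eq_zero_iff hxx' hx'x n).2 hx]
  rfl

theorem two_mul_finrank_adjoin_le_finrank {k V : Type*} [Field k] [AddCommGroup V] [Module k V]
    [FiniteDimensional k V] [Nontrivial V] (h2 : (2 : k) ≠ 0) {n : ℕ} {ε : AlgebraicClosure k}
    (hε : ε ^ 2 ^ (n + 2) = -1) {x x' y : Module.End k V} (hxx' : x * x' = 1) (hx'x : x' * x = 1)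
    (hyy : y * y = 1) (hyx : y * x = -(x' * y)) (hx : x ^ 2 ^ (n + 2) = -1) :
    2 * Module.finrank k (IntermediateField.adjoin k {ε - ε⁻¹}) ≤ Module.finrank k V := by
  have h₁ := finrank_adjoin_le_finrank_ker h2 hε hxx' hx'x hyy hyx hx
  have h₂ := finrank_adjoin_le_finrank_ker h2 hε hxx' hx'x (y := -y) (by rw [neg_mul_neg, hyy])
    (by rw [neg_mul, mul_neg, hyx]) hx
  have hdis : Disjoint (LinearMap.ker (y - 1)) (LinearMap.ker (-y - 1)) := by
    rw [Submodule.disjoint_def]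
    intro w hw hw'
    rw [LinearMap.mem_ker] at hw hw'
    have h : (2 : k) • w = -((y - 1) w + (-y - 1) w) := by
      rw [two_smul]
      simp only [LinearMap.sub_apply, LinearMap.neg_apply, Module.End.one_apply]
      abel
    rw [hw, hw', add_zero, neg_zero] at h
    exact (smul_eq_zero.1 h).resolve_left h2
  have := Submodule.finrank_add_finrank_le_of_disjoint hdis
  omega

theorem iSupIndep.sum_finrank_le {k V ι : Type*} [Field k] [AddCommGroup V] [Module k V]
    [FiniteDimensional k V] {E : ι → Submodule k V} (hE : iSupIndep E) (S : Finset ι) :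
    ∑ i ∈ S, Module.finrank k (E i) ≤ Module.finrank k V := by
  classical
  have h : iSupIndep fun i : S => E i := hE.comp Subtype.val_injective
  have := LinearMap.finrank_le_finrank_of_injective
    (f := (DFinsupp.lsum ℕ fun i : S => (E i).subtype : (Π₀ i : S, E i) →ₗ[k] V))
    h.dfinsupp_lsum_injective
  rw [← Finset.sum_coe_sort S fun i => Module.finrank k (E i)]
  exact (Module.finrank_directSum k fun i : S => E i).symm.trans_le this

namespace Module.End

theorem maxGenEigenspace_eq_eigenspace_of_mul_self {k V : Type*} [Field k] [AddCommGroup V] [Module k V]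
    (h2 : (2 : k) ≠ 0) {z : Module.End k V} (hz : z * z = 1) (μ : k) :
    z.maxGenEigenspace μ = z.eigenspace μ := by
  refine IsFinitelySemisimple.maxGenEigenspace_eq_eigenspace ?_ μ
  refine IsSemisimple.isFinitelySemisimple ?_
  refine isSemisimple_of_squarefree_aeval_eq_zero (p := X ^ 2 - 1) ?_ ?_
  · refine Separable.squarefree ?_
    rw [← C_1]
    exact separable_X_pow_sub_C 1 (by exact_mod_cast h2) one_ne_zero
  · simp [sq, hz]

theorem iSup_eigenspace_of_mul_self {k V : Type*} [Field k] [AddCommGroup V] [Module k V]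
    (h2 : (2 : k) ≠ 0) {z : Module.End k V} (hz : z * z = 1) : ⨆ μ, z.eigenspace μ = ⊤ := by
  rw [eq_top_iff]
  intro v _
  have hzz : z (z v) = v := by rw [← Module.End.mul_apply, hz]; rfl
  have h₁ : v + z v ∈ z.eigenspace 1 := by
    rw [mem_eigenspace_iff, map_add, hzz, one_smul, add_comm]
  have h₂ : v - z v ∈ z.eigenspace (-1) := by
    rw [mem_eigenspace_iff, map_sub, hzz, neg_one_smul, neg_sub]
  have h : v = (2 : k)⁻¹ • ((v + z v) + (v - z v)) := by
    rw [add_add_sub_cancel, ← two_smul k v, inv_smul_smul₀ h2]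
  rw [h]
  exact Submodule.smul_mem _ _ (add_mem (Submodule.mem_iSup_of_mem 1 h₁)
    (Submodule.mem_iSup_of_mem (-1) h₂))

/-- If commuting involutions generate a group of rank `m` and every simultaneous eigenspace for a
nontrivial character has dimension at least `d`, then the dimension is at least `m * d`. -/
theorem mul_le_finrank_of_commuting_involutions {k V : Type*} [Field k] [AddCommGroup V]
    [Module k V] [FiniteDimensional k V] (h2 : (2 : k) ≠ 0) {m : ℕ} {z : Fin m → Module.End k V}
    (hz : ∀ i, z i * z i = 1) (hc : Pairwise fun i j => Commute (z i) (z j))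
    {g : Finset (Fin m) → Module.End k V} (hg : Function.Injective g) (hg₀ : g ∅ = 1)
    (hg₁ : ∀ i a, i ∉ a → g (insert i a) = z i * g a) {d : ℕ}
    (hd : ∀ χ : Fin m → k, ⨅ i, (z i).eigenspace (χ i) ≠ ⊥ → ∀ i, χ i = -1 →
      d ≤ Module.finrank k (⨅ i, (z i).eigenspace (χ i) : Submodule k V)) :
    m * d ≤ Module.finrank k V := by
  classical
  set E : (Fin m → k) → Submodule k V := fun χ => ⨅ i, (z i).eigenspace (χ i) with hE
  have hEgen : E = fun χ => ⨅ i, (z i).maxGenEigenspace (χ i) := by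
    simp only [hE, maxGenEigenspace_eq_eigenspace_of_mul_self h2 (hz _)]
  have hind : iSupIndep E := by
    rw [hEgen]
    refine independent_iInf_maxGenEigenspace_of_forall_mapsTo z fun i j φ =>
      mapsTo_maxGenEigenspace_of_comm ?_ φ
    rcases eq_or_ne j i with rfl | h
    · exact Commute.refl _
    · exact hc h
  have htop : ⨆ χ, E χ = ⊤ := by
    rw [hEgen]
    refine iSup_iInf_maxGenEigenspace_eq_top_of_iSup_maxGenEigenspace_eq_top_of_commute z hc
      fun i => ?_
    simp only [maxGenEigenspace_eq_eigenspace_of_mul_self h2 (hz _)]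
    exact iSup_eigenspace_of_mul_self h2 (hz i)
  have hzE {χ : Fin m → k} {v : V} (hv : v ∈ E χ) (i : Fin m) : z i v = χ i • v :=
    mem_eigenspace_iff.1 ((Submodule.mem_iInf _).1 hv i)
  have hsign {χ : Fin m → k} (h : E χ ≠ ⊥) (i : Fin m) : χ i = 1 ∨ χ i = -1 := by
    obtain ⟨v, hv, hv0⟩ := (Submodule.ne_bot_iff _).1 h
    have h1 : z i (z i v) = v := by rw [← Module.End.mul_apply, hz]; rfl
    rw [hzE hv, map_smul, hzE hv, smul_smul] at h1
    have h3 : (χ i * χ i - 1) • v = 0 := by rw [sub_smul, h1, one_smul, sub_self]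
    have h4 := (smul_eq_zero.1 h3).resolve_right hv0
    rw [← mul_self_eq_one_iff]
    linear_combination h4
  have hgE {χ : Fin m → k} {v : V} (hv : v ∈ E χ) (a : Finset (Fin m)) :
      g a v = (∏ i ∈ a, χ i) • v := by
    induction a using Finset.induction_on with
    | empty => simp [hg₀]
    | insert i a hi ih =>
      rw [hg₁ i a hi, Module.End.mul_apply, ih, map_smul, hzE hv, smul_smul,
        Finset.prod_insert hi, mul_comm]
  have hfin : {χ | E χ ≠ ⊥}.Finite := WellFoundedGT.finite_ne_bot_of_iSupIndep hind
  let S : Finset (Fin m → k) := hfin.toFinset.erase 1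
  have hprod {χ : Fin m → k} (h : E χ ≠ ⊥) (a : Finset (Fin m)) :
      ∏ i ∈ a, χ i = 1 ∨ ∏ i ∈ a, χ i = -1 := by
    induction a using Finset.induction_on with
    | empty => simp
    | insert i a hi ih =>
      rw [Finset.prod_insert hi]
      rcases hsign h i with h1 | h1 <;> rcases ih with h3 | h3 <;> simp [h1, h3]
  let F : Finset (Fin m) → Finset (Fin m → k) := fun a => S.filter fun χ => ∏ i ∈ a, χ i = 1
  have hF : Function.Injective F := by
    intro a b hab
    refine hg (LinearMap.ext fun v => ?_)
    have hle : ⨆ χ, E χ ≤ LinearMap.eqLocus (g a) (g b) := by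
      refine iSup_le fun χ v hv => ?_
      rw [LinearMap.mem_eqLocus, hgE hv, hgE hv]
      by_cases hbot : E χ = ⊥
      · rw [hbot, Submodule.mem_bot] at hv
        simp [hv]
      · by_cases h1 : χ = 1
        · simp [h1]
        · have hχ : χ ∈ S := by simp [S, h1, hbot]
          have hiff : ∏ i ∈ a, χ i = 1 ↔ ∏ i ∈ b, χ i = 1 := by
            have := congrArg (χ ∈ ·) hab
            simpa [F, hχ] using this
          congr 1
          rcases hprod hbot a with h3 | h3
          · rw [h3, hiff.1 h3]
          · rcases hprod hbot b with h4 | h4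
            · rw [h4, hiff.2 h4]
            · rw [h3, h4]
    exact hle (htop ▸ Submodule.mem_top)
  have hcard : m ≤ S.card := by
    have h := Finset.card_le_card_of_injOn F (s := Finset.univ) (t := S.powerset)
      (fun a _ =>
      Finset.mem_coe.2 (Finset.mem_powerset.2 (Finset.filter_subset (fun χ => ∏ i ∈ a, χ i = 1) S)))
      hF.injOn
    rw [Finset.card_univ, Fintype.card_finset, Fintype.card_fin, Finset.card_powerset] at h
    exact (Nat.pow_le_pow_iff_right (by norm_num)).1 h
  calc m * d ≤ S.card * d := Nat.mul_le_mul_right d hcard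
    _ = ∑ _χ ∈ S, d := by simp
    _ ≤ ∑ χ ∈ S, Module.finrank k (E χ) := by
      refine Finset.sum_le_sum fun χ hχ => ?_
      simp only [S, Finset.mem_erase, Set.Finite.mem_toFinset, Set.mem_ofPred_eq] at hχ
      obtain ⟨i, hi⟩ := Function.ne_iff.1 hχ.1
      exact hd χ hχ.2 i ((hsign hχ.2 i).resolve_left hi)
    _ ≤ Module.finrank k V := hind.sum_finrank_le S

end Module.End

namespace Semidihedral

theorem commute_rot_pow_half (n : ℕ) (g : Semidihedral n) : Commute (rot n ^ 2 ^ (n + 2)) g := by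
  have hrot : Commute (rot n ^ 2 ^ (n + 2)) (rot n) := (Commute.refl _).pow_left _
  have hrefl : Commute (rot n ^ 2 ^ (n + 2)) (refl n) := by
    have h := (show SemiconjBy (refl n) (rot n) (rot n ^ (2 ^ (n + 2) - 1)) from
      refl_mul_rot n).pow_right (2 ^ (n + 2))
    have hodd : Odd (2 ^ (n + 2) - 1) :=
      Nat.Even.sub_odd Nat.one_le_two_pow (by simp [Nat.even_pow]) odd_one
    obtain ⟨l, hl⟩ := hodd
    have hsq : (rot n ^ 2 ^ (n + 2)) ^ 2 = 1 := by rw [← pow_mul, ← pow_succ, rot_pow_two_pow]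
    have hw : (rot n ^ (2 ^ (n + 2) - 1)) ^ 2 ^ (n + 2) = rot n ^ 2 ^ (n + 2) :=
      calc (rot n ^ (2 ^ (n + 2) - 1)) ^ 2 ^ (n + 2)
          = (rot n ^ 2 ^ (n + 2)) ^ (2 ^ (n + 2) - 1) := pow_right_comm _ _ _
        _ = (rot n ^ 2 ^ (n + 2)) ^ (2 * l + 1) := congrArg ((rot n ^ 2 ^ (n + 2)) ^ ·) hl
        _ = rot n ^ 2 ^ (n + 2) := by rw [pow_succ, pow_mul, hsq, one_pow, one_mul]
    rw [hw] at h
    exact h.symm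
  obtain ⟨i, u⟩ := g
  have hg : (⟨i, u⟩ : Semidihedral n) = rot n ^ (ZMod.val i.toAdd) * SemidirectProduct.inr u := by
    rw [rot_pow, ZMod.natCast_zmod_val, SemidirectProduct.mk_eq_inl_mul_inr]
    rfl
  rw [hg]
  refine (hrot.pow_right _).mul_right ?_
  rcases Int.units_eq_one_or u with rfl | rfl
  · rw [map_one]
    exact Commute.one_right _
  · exact hrefl

theorem mul_finrank_le_of_injective {k V : Type*} [Field k] [AddCommGroup V]
    [Module k V] [FiniteDimensional k V] (h2 : (2 : k) ≠ 0) {n m : ℕ} {ε : AlgebraicClosure k}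
    (hε : ε ^ 2 ^ (n + 2) = -1) {ρ : (Fin m → Semidihedral n) →* Module.End k V}
    (hρ : Function.Injective ρ) :
    m * (2 * Module.finrank k (IntermediateField.adjoin k {ε - ε⁻¹})) ≤ Module.finrank k V := by
  classical
  set c := rot n ^ 2 ^ (n + 2) with hcdef
  have hcc : c * c = 1 := by rw [← sq, ← pow_mul, ← pow_succ, rot_pow_two_pow]
  have hc1 : c ≠ 1 := rot_pow_half_ne_one n
  have hcentral (i : Fin m) (f : Fin m → Semidihedral n) : Commute (Pi.mulSingle i c) f := by
    refine funext fun j => ?_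
    rw [Pi.mul_apply, Pi.mul_apply]
    rcases eq_or_ne j i with rfl | h
    · rw [Pi.mulSingle_eq_same]
      exact commute_rot_pow_half n (f j)
    · rw [Pi.mulSingle_eq_of_ne h, one_mul, mul_one]
  let z : Fin m → Module.End k V := fun i => ρ (Pi.mulSingle i c)
  have hzcomm (i : Fin m) (f : Fin m → Semidihedral n) : Commute (z i) (ρ f) :=
    (hcentral i f).map ρ
  refine Module.End.mul_le_finrank_of_commuting_involutions h2 (z := z)
    (g := fun a => ρ fun i => if i ∈ a then c else 1) ?_ ?_ ?_ ?_ ?_ ?_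
  · intro i
    rw [← map_mul, ← Pi.mulSingle_mul, hcc, Pi.mulSingle_one, map_one]
  · exact fun i j _ => hzcomm i _
  · intro a b hab
    ext i
    have := congrFun (hρ hab) i
    by_cases ha : i ∈ a <;> by_cases hb : i ∈ b <;> simp_all
  · rw [← map_one ρ]
    congr 1
  · intro i a hi
    rw [← map_mul]
    congr 1
    ext1 j
    rcases eq_or_ne j i with rfl | h
    · simp [hi]
    · simp [h]
  · intro χ hχ i hi
    set E : Submodule k V := ⨅ i, (z i).eigenspace (χ i) with hE
    have hstab (f : Fin m → Semidihedral n) : ∀ v ∈ E, ρ f v ∈ E := by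
      intro v hv
      simp only [hE, Submodule.mem_iInf, Module.End.mem_eigenspace_iff] at hv ⊢
      intro j
      rw [← Module.End.mul_apply, (hzcomm j f).eq, Module.End.mul_apply, hv, map_smul]
    let σ : (Fin m → Semidihedral n) →* Module.End k E :=
      { toFun := fun f => (ρ f).restrict (hstab f)
        map_one' := by ext; simp
        map_mul' := fun f g => by ext; simp }
    let τ : Semidihedral n →* Module.End k E := σ.comp (MonoidHom.mulSingle (fun _ => Semidihedral n) i)
    have hτc : τ c = -1 := by
      ext v
      have := v.2
      simp only [hE, Submodule.mem_iInf, Module.End.mem_eigenspace_iff] at this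
      have h := this i
      rw [hi, neg_one_smul] at h
      exact h
    have : Nontrivial E := Submodule.nontrivial_iff_ne_bot.2 hχ
    refine two_mul_finrank_adjoin_le_finrank h2 hε (x := τ (rot n)) (x' := τ (rot n)⁻¹)
      (y := τ (refl n)) ?_ ?_ ?_ ?_ ?_
    · rw [← map_mul, mul_inv_cancel, map_one]
    · rw [← map_mul, inv_mul_cancel, map_one]
    · rw [← map_mul, refl_mul_self, map_one]
    · have : rot n ^ (2 ^ (n + 2) - 1) = (rot n)⁻¹ * c := by
        rw [hcdef, eq_inv_mul_iff_mul_eq, ← pow_succ', Nat.sub_add_cancel Nat.one_le_two_pow]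
      rw [← map_mul, refl_mul_rot, this, map_mul, map_mul, hτc]
      exact (congrArg (· * τ (refl n)) (mul_neg_one _)).trans (neg_mul _ _)
    · rw [← map_pow, ← hcdef, hτc]

end Semidihedral

theorem stmt1 (p r q s : ℕ) (hp : p.Prime) (hodd : p ≠ 2) (hr : 1 ≤ r)
    (hq : q = p ^ r) (hq4 : q % 4 = 3) (hs : s = padicValNat 2 (q + 1) + 1)
    (k : Type*) [Field k] (hchar : ringChar k ≠ 2)
    (ε : AlgebraicClosure k) (hε : IsPrimitiveRoot ε (2 ^ s))
    (F : Type*) [Field F] [Fintype F] (hF : Fintype.card F = q)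
    (m : ℕ) (hm : 1 ≤ m)
    (P : Sylow 2 (Matrix.GeneralLinearGroup (Fin (2 * m)) F)) :
    minFaithfulDim k (P : Subgroup (Matrix.GeneralLinearGroup (Fin (2 * m)) F)) =
      2 * m * Module.finrank k (IntermediateField.adjoin k {ε - ε⁻¹}) := by
  have h2 : (2 : k) ≠ 0 := Ring.two_ne_zero hchar
  have h2' : (2 : AlgebraicClosure k) ≠ 0 := by
    rw [← map_ofNat (algebraMap k (AlgebraicClosure k)) 2]
    exact (_root_.map_ne_zero _).2 h2
  subst hF
  obtain ⟨n, hn⟩ : ∃ n, padicValNat 2 (Fintype.card F + 1) = n + 2 := by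
    refine Nat.exists_eq_add_of_le' ?_
    rw [← padicValNat_dvd_iff_le (by omega)]
    omega
  obtain rfl : s = n + 3 := by omega
  have hε' : ε ^ 2 ^ (n + 2) = -1 := (isPrimitiveRoot_iff_pow_eq_neg_one h2').1 hε
  have hε0 : ε ≠ 0 := hε.ne_zero (by positivity)
  have hF2 : (2 : F) ≠ 0 := by
    intro h
    have h1 := FiniteField.cast_card_eq_zero F
    rw [← Nat.div_add_mod (Fintype.card F) 4, hq4] at h1
    push_cast at h1
    refine one_ne_zero (α := F) ?_
    linear_combination h1 - (2 * (Fintype.card F / 4 : ℕ) + 1) * h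
  have hH := Semidihedral.natCard n
  have : Finite (Semidihedral n) := Nat.finite_of_card_ne_zero (by rw [hH]; positivity)
  have : Finite (SymWreath (Semidihedral n) m) :=
    Nat.finite_of_card_ne_zero (by rw [natCard_symWreath, hH]; positivity)
  obtain ⟨t, ht⟩ := exists_aeval_tracePoly_eq_zero hn
  obtain ⟨f, hf⟩ := Semidihedral.exists_injective_end n hF2 ht
  have hg := exists_injective_GL (wreathEnd f m) (wreathEnd_injective hf m)
  rw [show Module.finrank F (Fin m → Fin 2 → F) = 2 * m by
    rw [Module.finrank_pi_fintype]; simp [mul_comm]] at hg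
  obtain ⟨g, hg⟩ := hg
  let Q : Sylow 2 (SymWreath (Semidihedral n) m) := default
  obtain ⟨ψ, hψ⟩ := Q.isPGroup'.exists_injective_sylow (g.comp (Subgroup.subtype _))
    (hg.comp Subtype.val_injective) P
  let e : Q ≃* P := MulEquiv.ofBijective ψ
    ((Nat.bijective_iff_injective_and_card ψ).2 ⟨hψ, natCard_sylow_symWreath_eq hq4 hn m Q P⟩)
  let L := IntermediateField.adjoin k {ε - ε⁻¹}
  let tL : L := ⟨ε - ε⁻¹, IntermediateField.mem_adjoin_simple_self k _⟩
  have htL : aeval tL (tracePoly k n) = 0 := by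
    refine (algebraMap L (AlgebraicClosure k)).injective ?_
    rw [← aeval_algebraMap_apply, map_zero]
    exact (aeval_tracePoly_eq_zero_iff (mul_inv_cancel₀ hε0) (inv_mul_cancel₀ hε0) n).2 hε'
  have hL2 : (2 : L) ≠ 0 := by
    rw [← map_ofNat (algebraMap k L) 2]
    exact (_root_.map_ne_zero _).2 h2
  have : FiniteDimensional k L :=
    IntermediateField.adjoin.finiteDimensional (Algebra.IsIntegral.isIntegral (ε - ε⁻¹))
  obtain ⟨fL, hfL⟩ := Semidihedral.exists_injective_end n hL2 htL
  obtain ⟨fk, hfk⟩ := exists_injective_end_restrictScalars k (wreathEnd fL m)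
    (wreathEnd_injective hfL m)
  have hφ := exists_injective_GL fk hfk
  rw [show Module.finrank k (Fin m → Fin 2 → L) = 2 * m * Module.finrank k L by
    rw [Module.finrank_pi_fintype, Module.finrank_pi_fintype]; simp; ring] at hφ
  obtain ⟨φ, hφ⟩ := hφ
  have hmem : 2 * m * Module.finrank k L ∈
      {d : ℕ | ∃ φ : P →* Matrix.GeneralLinearGroup (Fin d) k, Function.Injective φ} :=
    ⟨(φ.comp (Subgroup.subtype _)).comp e.symm.toMonoidHom,
      (hφ.comp Subtype.val_injective).comp e.symm.injective⟩
  refine le_antisymm (Nat.sInf_le hmem) (le_csInf ⟨_, hmem⟩ ?_)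
  rintro d ⟨χ, hχ⟩
  have hbase : IsPGroup 2 (Fin m → Semidihedral n) :=
    IsPGroup.of_card (n := (n + 4) * m) (by rw [Nat.card_fun, hH, ← pow_mul]; simp)
  obtain ⟨β, hβ⟩ := hbase.exists_injective_sylow (g.comp SemidirectProduct.inl)
    (hg.comp SemidirectProduct.inl_injective) P
  let E : Matrix (Fin d) (Fin d) k ≃ₐ[k] Module.End k (Fin d → k) := Matrix.toLinAlgEquiv'
  let χ' : P →* Matrix (Fin d) (Fin d) k := (Units.coeHom _).comp χ
  have := Semidihedral.mul_finrank_le_of_injective h2 hε'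
    (ρ := E.toAlgHom.toRingHom.toMonoidHom.comp (χ'.comp β))
    (E.injective.comp ((Units.val_injective.comp hχ).comp hβ))
  rw [Module.finrank_fin_fun] at this
  linarith
end

section
/- Let p be an odd prime, q = p^r with q ≡ 3 (mod 4), and s = v₂(q+1)+1. Let k be a field of characteristic ≠ 2 and let ε be a primitive 2^s-th root of unity in a fixed algebraic closure of k. Then for every m ≥ 1 and every Sylow 2-subgroup P of GL_{2m+1}(F_q), the minimal faithful representation dimension of P over k equals 2m·[k(ε−ε⁻¹):k] + 1. -/
/-- The semidihedral group of order `2 ^ (n + 4)`: `rot i` stands for `x ^ i` and `refl i` for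
`x ^ i * y`, where `x ^ 2 ^ (n + 3) = 1`, `y ^ 2 = 1` and `y * x * y = x ^ (2 ^ (n + 2) - 1)`. -/
inductive SemidihedralGroup (n : ℕ) : Type
  | rot : ZMod (2 ^ (n + 3)) → SemidihedralGroup n
  | refl : ZMod (2 ^ (n + 3)) → SemidihedralGroup n

namespace SemidihedralGroup

variable {n : ℕ}

/-- The exponent by which a reflection twists the rotations. -/
def twist (n : ℕ) : ZMod (2 ^ (n + 3)) := 2 ^ (n + 2) - 1

theorem two_pow_eq_zero (n : ℕ) : (2 : ZMod (2 ^ (n + 3))) ^ (n + 3) = 0 := by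
  exact_mod_cast ZMod.natCast_self (2 ^ (n + 3))

theorem twist_mul_twist (n : ℕ) : twist n * twist n = 1 := by
  have h := two_pow_eq_zero n
  have h2 : twist n * twist n =
      2 ^ (n + 3) * 2 ^ (n + 1) - (2 : ZMod (2 ^ (n + 3))) ^ (n + 3) + 1 := by
    unfold twist; ring
  rw [h2, h]; ring

theorem twist_mul_two_pow (n : ℕ) : twist n * 2 ^ (n + 2) = 2 ^ (n + 2) := by
  have h := two_pow_eq_zero n
  have h2 : twist n * 2 ^ (n + 2) =
      2 ^ (n + 3) * 2 ^ (n + 1) - (2 : ZMod (2 ^ (n + 3))) ^ (n + 3) + 2 ^ (n + 2) := by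
    unfold twist; ring
  rw [h2, h]; ring

instance : Mul (SemidihedralGroup n) where
  mul
    | rot i, rot j => rot (i + j)
    | rot i, refl j => refl (i + j)
    | refl i, rot j => refl (i + twist n * j)
    | refl i, refl j => rot (i + twist n * j)

instance : One (SemidihedralGroup n) := ⟨rot 0⟩

instance : Inv (SemidihedralGroup n) where
  inv
    | rot i => rot (-i)
    | refl i => refl (-(twist n * i))

theorem one_def : (1 : SemidihedralGroup n) = rot 0 := rfl

@[simp]
theorem rot_mul_rot (i j : ZMod (2 ^ (n + 3))) : rot i * rot j = rot (i + j) := rfl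

@[simp]
theorem rot_mul_refl (i j : ZMod (2 ^ (n + 3))) : rot i * refl j = refl (i + j) := rfl

@[simp]
theorem refl_mul_rot (i j : ZMod (2 ^ (n + 3))) :
    refl i * rot j = refl (i + twist n * j) := rfl

@[simp]
theorem refl_mul_refl (i j : ZMod (2 ^ (n + 3))) :
    refl i * refl j = rot (i + twist n * j) := rfl

instance : Group (SemidihedralGroup n) where
  mul_assoc := by
    have h := twist_mul_twist n
    rintro (i | i) (j | j) (k | k) <;> simp <;> grind
  one_mul := by rintro (i | i) <;> simp [one_def]
  mul_one := by rintro (i | i) <;> simp [one_def]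
  inv_mul_cancel := by
    rintro (i | i)
    · exact congrArg rot (neg_add_cancel i)
    · exact congrArg rot (neg_add_cancel _)

/-- The semidihedral group as a set is a sum of two copies of `ZMod (2 ^ (n + 3))`. -/
def equivSum (n : ℕ) : SemidihedralGroup n ≃ ZMod (2 ^ (n + 3)) ⊕ ZMod (2 ^ (n + 3)) where
  toFun
    | rot i => .inl i
    | refl i => .inr i
  invFun
    | .inl i => rot i
    | .inr i => refl i
  left_inv := by rintro (i | i) <;> rfl
  right_inv := by rintro (i | i) <;> rfl

instance : Finite (SemidihedralGroup n) := .of_equiv _ (equivSum n).symm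

theorem card (n : ℕ) : Nat.card (SemidihedralGroup n) = 2 ^ (n + 4) := by
  rw [Nat.card_congr (equivSum n), Nat.card_sum, Nat.card_zmod]
  ring

theorem rot_one_pow (k : ℕ) : (rot 1 : SemidihedralGroup n) ^ k = rot k := by
  induction k with
  | zero => simp [one_def]
  | succ k ih => rw [pow_succ, ih]; simp

/-- The central involution. -/
def involution (n : ℕ) : SemidihedralGroup n := rot (2 ^ (n + 2))

theorem rot_one_pow_two_pow : (rot 1 : SemidihedralGroup n) ^ 2 ^ (n + 2) = involution n := by
  rw [rot_one_pow, involution]; push_cast; rfl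

theorem involution_mul_self : involution n * involution n = 1 := by
  rw [involution, rot_mul_rot, one_def, ← two_pow_eq_zero n]; ring_nf

theorem involution_ne_one : involution n ≠ 1 := by
  intro h
  rw [involution, one_def, rot.injEq] at h
  have h2 : ((2 ^ (n + 2) : ℕ) : ZMod (2 ^ (n + 3))) = 0 := by exact_mod_cast h
  rw [ZMod.natCast_eq_zero_iff, Nat.pow_dvd_pow_iff_le_right (by norm_num)] at h2
  omega

theorem commute_involution (g : SemidihedralGroup n) : Commute (involution n) g := by
  rcases g with i | i
  · exact congrArg rot (add_comm _ _)
  · refine congrArg refl ?_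
    rw [twist_mul_two_pow]
    exact add_comm _ _

theorem rot_mul_refl_mul_rot :
    (rot 1 * refl 0 * rot 1 : SemidihedralGroup n) = involution n * refl 0 := by
  simp [involution, twist]

theorem refl_mul_self : (refl 0 * refl 0 : SemidihedralGroup n) = 1 := by
  simp [one_def]

/-- The embedding of the group of order two as the centre. -/
def ofUnits (n : ℕ) : ℤˣ →* SemidihedralGroup n where
  toFun u := if u = 1 then 1 else involution n
  map_one' := by simp
  map_mul' u v := by
    rcases Int.units_eq_one_or u with rfl | rfl <;> rcases Int.units_eq_one_or v with rfl | rfl <;>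
      simp [involution_mul_self]

theorem ofUnits_neg_one : ofUnits n (-1) = involution n := by
  simp [ofUnits]

theorem ofUnits_injective : Function.Injective (ofUnits n) := by
  rw [injective_iff_map_eq_one]
  intro u hu
  rcases Int.units_eq_one_or u with rfl | rfl
  · rfl
  · exact absurd (ofUnits_neg_one ▸ hu) involution_ne_one

theorem commute_ofUnits (u : ℤˣ) (g : SemidihedralGroup n) : Commute (ofUnits n u) g := by
  rcases Int.units_eq_one_or u with rfl | rfl
  · simp
  · exact ofUnits_neg_one ▸ commute_involution g

section lift

variable {M : Type*} [Monoid M]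

theorem pow_val_natCast (X : M) (hX : X ^ 2 ^ (n + 3) = 1) (j : ℕ) :
    X ^ (j : ZMod (2 ^ (n + 3))).val = X ^ j := by
  rw [ZMod.val_natCast, ← pow_eq_pow_mod j hX]

theorem pow_val_add (X : M) (hX : X ^ 2 ^ (n + 3) = 1) (i j : ZMod (2 ^ (n + 3))) :
    X ^ (i + j).val = X ^ i.val * X ^ j.val := by
  rw [← pow_add, ← pow_val_natCast X hX (i.val + j.val)]
  simp

theorem mul_pow_val (X Y : M) (hX : X ^ 2 ^ (n + 3) = 1) (hXY : X * Y * X = X ^ 2 ^ (n + 2) * Y)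
    (j : ZMod (2 ^ (n + 3))) :
    Y * X ^ j.val = X ^ (twist n * j).val * Y := by
  have h1 : SemiconjBy Y X (X ^ (2 ^ (n + 2) - 1)) := by
    have h2 : X ^ (2 ^ (n + 3) - 1) * (X * Y * X) = Y * X := by
      rw [mul_assoc X, ← mul_assoc, ← pow_succ, Nat.sub_add_cancel Nat.one_le_two_pow, hX, one_mul]
    have h3 : X ^ (2 ^ (n + 3) - 1) * X ^ 2 ^ (n + 2) = X ^ (2 ^ (n + 2) - 1) := by
      have h4 : 2 ^ (n + 3) - 1 + 2 ^ (n + 2) = 2 ^ (n + 3) + (2 ^ (n + 2) - 1) := by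
        have := Nat.one_le_two_pow (n := n + 3)
        have := Nat.one_le_two_pow (n := n + 2)
        omega
      rw [← pow_add, h4, pow_add, hX, one_mul]
    rw [SemiconjBy, ← h2, hXY, ← mul_assoc, h3]
  have h5 := (h1.pow_right j.val).eq
  rw [h5, ← pow_mul, ← pow_val_natCast X hX ((2 ^ (n + 2) - 1) * j.val)]
  simp [twist, Nat.cast_sub Nat.one_le_two_pow]

variable (X Y : M) (hX : X ^ 2 ^ (n + 3) = 1) (hY : Y * Y = 1)
  (hXY : X * Y * X = X ^ 2 ^ (n + 2) * Y)

/-- The homomorphism out of the semidihedral group given by elements satisfying its defining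
relations. -/
def lift : SemidihedralGroup n →* M where
  toFun
    | rot i => X ^ i.val
    | refl i => X ^ i.val * Y
  map_one' := by simp
  map_mul' := by
    rintro (i | i) (j | j)
    · simp [pow_val_add X hX]
    · simp [pow_val_add X hX, mul_assoc]
    · simp only [pow_val_add X hX, mul_assoc, mul_pow_val X Y hX hXY]
    · simp only [pow_val_add X hX]
      rw [mul_assoc (X ^ i.val), ← mul_assoc Y, mul_pow_val X Y hX hXY, mul_assoc _ Y Y, hY, mul_one]

theorem lift_rot_one : lift X Y hX hY hXY (rot 1) = X := by
  have h := pow_val_natCast X hX 1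
  simpa [lift] using h

theorem lift_injective (h : X ^ 2 ^ (n + 2) ≠ 1) :
    Function.Injective (lift X Y hX hY hXY) := by
  rw [injective_iff_map_eq_one]
  rintro (i | i) hi
  · have : Fact (Nat.Prime 2) := ⟨Nat.prime_two⟩
    have h1 : orderOf X = 2 ^ (n + 3) := orderOf_eq_prime_pow h hX
    have h2 : X ^ i.val = 1 := hi
    have h3 := orderOf_dvd_of_pow_eq_one h2
    rw [h1] at h3
    replace h3 := Nat.eq_zero_of_dvd_of_lt h3 i.val_lt
    rw [one_def, (ZMod.val_eq_zero i).1 h3]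
  · refine absurd ?_ h
    have h1 : (rot 1 * refl i * rot 1 : SemidihedralGroup n) = involution n * refl i := by
      simp only [involution, twist, rot_mul_refl, refl_mul_rot]
      ring_nf
    have h2 := congrArg (lift X Y hX hY hXY) h1
    rw [← rot_one_pow_two_pow, map_mul, map_mul, map_mul, map_pow, hi, lift_rot_one, mul_one,
      mul_one, ← sq] at h2
    have h3 : X ^ 2 ^ (n + 2) = (X ^ 2) ^ 2 ^ (n + 1) := by rw [← pow_mul]; ring_nf
    rw [h3, h2, ← pow_mul]
    have h4 : 2 ^ (n + 2) * 2 ^ (n + 1) = 2 ^ (n + 3) * 2 ^ n := by ring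
    rw [h4, pow_mul, hX, one_pow]

end lift

end SemidihedralGroup

theorem IsPrimitiveRoot.pow_two_pow_eq_neg_one {R : Type*} [CommRing R] [IsDomain R] {e : R} {n : ℕ}
    (he : IsPrimitiveRoot e (2 ^ (n + 1))) : e ^ 2 ^ n = -1 := by
  have h1 : e ^ 2 ^ n * e ^ 2 ^ n = 1 := by
    rw [← pow_add, ← two_mul, ← pow_succ', he.pow_eq_one]
  have h2 : e ^ 2 ^ n ≠ 1 := he.pow_ne_one_of_pos_of_lt (by positivity)
    (Nat.pow_lt_pow_right (by norm_num) (by omega))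
  exact (mul_self_eq_one_iff.1 h1).resolve_left h2

theorem isPrimitiveRoot_of_pow_two_pow_eq_neg_one {R : Type*} [CommRing R] [IsDomain R] {e : R}
    {n : ℕ} (h2 : (-1 : R) ≠ 1) (he : e ^ 2 ^ n = -1) : IsPrimitiveRoot e (2 ^ (n + 1)) := by
  have : Fact (Nat.Prime 2) := ⟨Nat.prime_two⟩
  have h3 : orderOf e = 2 ^ (n + 1) := by
    apply orderOf_eq_prime_pow
    · rwa [he]
    · rw [pow_succ, pow_mul, he]; norm_num
  exact h3 ▸ IsPrimitiveRoot.orderOf e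

namespace SemidihedralGroup

variable {n : ℕ}

theorem exists_injective_matrix {K L : Type*} [Field K] [Field L] [Algebra K L] {e : L}
    (he : IsPrimitiveRoot e (2 ^ (n + 3))) {a : K} (ha : algebraMap K L a = e - e⁻¹) :
    ∃ f : SemidihedralGroup n →* Matrix (Fin 2) (Fin 2) K, Function.Injective f := by
  have he0 : e ≠ 0 := he.ne_zero (by positivity)
  have hneg : e ^ 2 ^ (n + 2) = -1 := he.pow_two_pow_eq_neg_one
  have hL : (-1 : L) ≠ 1 := by
    rw [← hneg]
    exact he.pow_ne_one_of_pos_of_lt (by positivity) (Nat.pow_lt_pow_right (by norm_num) (by omega))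
  have hK : (-1 : K) ≠ 1 := fun h ↦ hL (by simpa using congrArg (algebraMap K L) h)
  have hsum : e + e⁻¹ ≠ 0 := by
    intro h
    have h1 : e ^ 2 = -1 := by
      field_simp at h; linear_combination h
    have h2 : e ^ 2 ^ (n + 2) = 1 := by
      have h3 : 2 ^ (n + 2) = 2 * (2 * 2 ^ n) := by ring
      rw [h3, pow_mul, pow_mul, h1]; norm_num
    exact hL (hneg ▸ h2)
  set X : Matrix (Fin 2) (Fin 2) K := !![a, 1; 1, 0] with hXdef
  set Y : Matrix (Fin 2) (Fin 2) K := !![1, -a; 0, -1] with hYdef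
  have hXX : X * X = a • X + 1 := by
    ext i j; fin_cases i <;> fin_cases j <;> simp [hXdef, Matrix.mul_apply, Fin.sum_univ_two]
  have key (j : ℕ) : ∃ c d : K, X ^ j = c • X + d • 1 ∧
      e ^ j = algebraMap K L c * e + algebraMap K L d ∧
      (-e⁻¹) ^ j = algebraMap K L c * (-e⁻¹) + algebraMap K L d := by
    induction j with
    | zero => exact ⟨0, 1, by simp⟩
    | succ j ih =>
      obtain ⟨c, d, h1, h2, h3⟩ := ih
      refine ⟨c * a + d, c, ?_, ?_, ?_⟩
      · rw [pow_succ, h1, add_mul, smul_mul_assoc, hXX, smul_mul_assoc, one_mul]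
        module
      · rw [pow_succ, h2, map_add, map_mul, ha]; field_simp; ring
      · rw [pow_succ, h3, map_add, map_mul, ha]; field_simp; ring
  have hX : X ^ 2 ^ (n + 2) = -1 := by
    obtain ⟨c, d, h1, h2, h3⟩ := key (2 ^ (n + 2))
    have h4 : (-e⁻¹) ^ 2 ^ (n + 2) = -1 := by
      rw [Even.neg_pow ((even_two).pow_of_ne_zero (by omega)), inv_pow, hneg]; norm_num
    rw [hneg] at h2
    rw [h4] at h3
    have h5 : algebraMap K L c = 0 := by
      have : algebraMap K L c * (e + e⁻¹) = 0 := by linear_combination h3 - h2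
      exact (mul_eq_zero.1 this).resolve_right hsum
    have h6 : algebraMap K L d = algebraMap K L (-1) := by
      rw [h5] at h2; simp [h2]
    rw [(map_eq_zero _).1 h5, (algebraMap K L).injective h6] at h1
    simpa using h1
  have hXM : (-1 : Matrix (Fin 2) (Fin 2) K) ≠ 1 := fun h ↦ hK (by simpa using congrFun₂ h 0 0)
  refine ⟨lift X Y ?_ ?_ ?_, lift_injective X Y _ _ _ (hX ▸ hXM)⟩
  · rw [pow_succ, pow_mul, hX]; norm_num
  · ext i j; fin_cases i <;> fin_cases j <;> simp [hYdef, Matrix.mul_apply, Fin.sum_univ_two]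
  · rw [hX]
    ext i j; fin_cases i <;> fin_cases j <;>
      simp [hXdef, hYdef, Matrix.mul_apply, Fin.sum_univ_two]

end SemidihedralGroup

open Polynomial

theorem pow_add_neg_inv_pow_mem {L S : Type*} [Field L] [SetLike S L] [SubringClass S L] {K : S}
    {e : L} (he : e ≠ 0) (h : e - e⁻¹ ∈ K) (i : ℕ) : e ^ i + (-e⁻¹) ^ i ∈ K := by
  induction i using Nat.twoStepInduction with
  | zero => simpa using add_mem (one_mem K) (one_mem K)
  | one => simpa [sub_eq_add_neg] using h
  | more i h1 h2 =>
    have h3 : e ^ (i + 2) + (-e⁻¹) ^ (i + 2) =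
        (e - e⁻¹) * (e ^ (i + 1) + (-e⁻¹) ^ (i + 1)) + (e ^ i + (-e⁻¹) ^ i) := by
      have h4 : e * e⁻¹ = 1 := mul_inv_cancel₀ he
      linear_combination ((-e⁻¹) ^ i + e ^ i) * h4
    rw [h3]
    exact add_mem (mul_mem h h2) h1

theorem IsPrimitiveRoot.adjoin_sub_inv_le {k L : Type*} [Field k] [Field L] [Algebra k L] {n : ℕ}
    {u e : L} (hu : IsPrimitiveRoot u (2 ^ (n + 1))) (he : IsPrimitiveRoot e (2 ^ (n + 1))) :
    IntermediateField.adjoin k {u - u⁻¹} ≤ IntermediateField.adjoin k {e - e⁻¹} := by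
  rw [IntermediateField.adjoin_simple_le_iff]
  obtain ⟨i, -, rfl⟩ := he.eq_pow_of_pow_eq_one hu.pow_eq_one
  have hi : Odd i := by
    rw [he.pow_iff_coprime (by positivity), Nat.coprime_pow_right_iff (by omega)] at hu
    exact Nat.coprime_two_right.1 hu
  have h := pow_add_neg_inv_pow_mem (he.ne_zero (by positivity))
    (IntermediateField.mem_adjoin_simple_self k (e - e⁻¹)) i
  rwa [hi.neg_pow, inv_pow, ← sub_eq_add_neg] at h

theorem Commute.aeval_right_of_commute {R A : Type*} [CommSemiring R] [Semiring A] [Algebra R A]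
    {Z T : A} (h : Commute Z T) (p : R[X]) : Commute Z (aeval T p) := by
  induction p using Polynomial.induction_on' with
  | add p q hp hq => simpa using hp.add_right hq
  | monomial i a =>
    rw [aeval_monomial]
    exact Commute.mul_right (Algebra.commute_algebraMap_right a Z) (h.pow_right i)

theorem two_mul_natDegree_le_finrank {k V : Type*} [Field k] [AddCommGroup V] [Module k V]
    [FiniteDimensional k V] [Nontrivial V] {f : k[X]} (hf : Irreducible f) {T X Y : Module.End k V}
    (hT : aeval T f = 0) (hX : Commute X T) (hY : Commute Y T)
    (hXY : ∀ v, v ≠ 0 → X (Y v) ≠ Y (X v)) :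
    2 * f.natDegree ≤ Module.finrank k V := by
  have : Fact (Irreducible f) := ⟨hf⟩
  let φ : AdjoinRoot f →ₐ[k] Module.End k V := Ideal.Quotient.liftₐ (Ideal.span {f}) (aeval T)
    (fun g hg ↦ by
      obtain ⟨h, rfl⟩ := Ideal.mem_span_singleton'.1 hg
      rw [map_mul, hT, mul_zero])
  have hφ (p : k[X]) : φ (AdjoinRoot.mk f p) = aeval T p := rfl
  let _ : Module (AdjoinRoot f) V := Module.compHom V φ.toRingHom
  have hsmul (c : AdjoinRoot f) (v : V) : c • v = φ c v := rfl
  have : IsScalarTower k (AdjoinRoot f) V := ⟨fun a c v ↦ by simp [hsmul]⟩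
  have hcomm {Z : Module.End k V} (hZ : Commute Z T) (c : AdjoinRoot f) (v : V) :
      Z (c • v) = c • Z v := by
    obtain ⟨p, rfl⟩ := AdjoinRoot.mk_surjective c
    rw [hsmul, hsmul, hφ]
    have h : Commute Z (aeval T p) := hZ.aeval_right_of_commute p
    exact LinearMap.congr_fun h.eq v
  have hfin : FiniteDimensional k (AdjoinRoot f) := (AdjoinRoot.powerBasis hf.ne_zero).finite
  have : Module.Finite (AdjoinRoot f) V := Module.Finite.right k (AdjoinRoot f) V
  have hdeg : Module.finrank k (AdjoinRoot f) = f.natDegree := by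
    rw [(AdjoinRoot.powerBasis hf.ne_zero).finrank, AdjoinRoot.powerBasis_dim]
  rw [← Module.finrank_mul_finrank k (AdjoinRoot f) V, hdeg, mul_comm]
  refine Nat.mul_le_mul_left _ ?_
  by_contra! h
  obtain ⟨v, hv⟩ := finrank_le_one_iff.1 (Nat.le_of_lt_succ h)
  have hv0 : v ≠ 0 := by
    rintro rfl
    obtain ⟨w, hw⟩ := exists_ne (0 : V)
    obtain ⟨c, hc⟩ := hv w
    exact hw (by simpa using hc.symm)
  obtain ⟨c, hc⟩ := hv (X v)
  obtain ⟨d, hd⟩ := hv (Y v)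
  refine hXY v hv0 ?_
  rw [← hc, ← hd, hcomm hX, hcomm hY, ← hc, ← hd, smul_comm]

namespace SemidihedralGroup

theorem two_mul_finrank_le {k V : Type*} [Field k] [AddCommGroup V] [Module k V]
    [FiniteDimensional k V] [Nontrivial V] {n : ℕ} {X Y : Module.End k V}
    (hX : X ^ 2 ^ (n + 2) = -1) (hY : Y * Y = 1) (hXY : X * Y * X = -Y)
    {e : AlgebraicClosure k} (he : IsPrimitiveRoot e (2 ^ (n + 3))) :
    2 * Module.finrank k (IntermediateField.adjoin k {e - e⁻¹}) ≤ Module.finrank k V := by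
  obtain ⟨N, hN⟩ : ∃ N, 2 ^ (n + 2) = N + 1 := ⟨_, (Nat.sub_add_cancel Nat.one_le_two_pow).symm⟩
  have hL : (-1 : AlgebraicClosure k) ≠ 1 := by
    rw [← he.pow_two_pow_eq_neg_one]
    exact he.pow_ne_one_of_pos_of_lt (by positivity) (Nat.pow_lt_pow_right (by norm_num) (by omega))
  have hint : IsIntegral k X := Algebra.IsIntegral.isIntegral X
  obtain ⟨u, hu⟩ := IsAlgClosed.exists_aeval_eq_zero (AlgebraicClosure k) (minpoly k X)
    (minpoly.degree_pos hint).ne'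
  have hu_pow : u ^ 2 ^ (n + 2) = -1 := by
    have h1 : minpoly k X ∣ Polynomial.X ^ 2 ^ (n + 2) + 1 := minpoly.dvd _ _ (by simp [hX])
    have h2 := aeval_eq_zero_of_dvd_aeval_eq_zero h1 hu
    simp only [map_add, map_pow, aeval_X, map_one] at h2
    exact eq_neg_of_add_eq_zero_left h2
  have hu_prim : IsPrimitiveRoot u (2 ^ (n + 3)) :=
    isPrimitiveRoot_of_pow_two_pow_eq_neg_one hL hu_pow
  rw [← le_antisymm (hu_prim.adjoin_sub_inv_le (k := k) he) (he.adjoin_sub_inv_le hu_prim)]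
  have hu_int (x : AlgebraicClosure k) : IsIntegral k x := Algebra.IsIntegral.isIntegral x
  rw [IntermediateField.adjoin.finrank (hu_int _)]
  set f := minpoly k (u - u⁻¹) with hf
  set h : k[X] := Polynomial.X + Polynomial.X ^ N with hh
  have hu0 : u ≠ 0 := hu_prim.ne_zero (by positivity)
  have hhu : aeval u h = u - u⁻¹ := by
    rw [hN, pow_succ] at hu_pow
    simp only [hh, map_add, map_pow, aeval_X]
    field_simp
    linear_combination hu_pow
  set T : Module.End k V := X + X ^ N with hT
  have hhX : aeval X h = T := by simp [hh, hT]
  have hXT : Commute X T := (Commute.refl X).add_right ((Commute.refl X).pow_right N)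
  have hYT : Commute Y T := by
    have h1 : X ^ N * X = -1 := by rw [← pow_succ, ← hN, hX]
    have h2 : X * X ^ N = -1 := by rw [← pow_succ', ← hN, hX]
    have h3 : X ^ N * (X * Y * X) = -(Y * X) := by
      rw [mul_assoc X, ← mul_assoc, h1, neg_one_mul]
    have h4 : (X * Y * X) * X ^ N = -(X * Y) := by
      rw [mul_assoc, h2, mul_neg_one]
    rw [hXY, mul_neg, neg_inj] at h3
    rw [hXY, neg_mul, neg_inj] at h4
    rw [Commute, SemiconjBy, hT, mul_add, add_mul, h3, h4, add_comm]
  set W : Submodule k V := LinearMap.ker (aeval T f) with hW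
  have hWmap {Z : Module.End k V} (hZ : Commute Z T) : ∀ w ∈ W, Z w ∈ W := by
    intro w hw
    have h : Commute Z (aeval T f) := hZ.aeval_right_of_commute f
    have h2 := LinearMap.congr_fun h.eq w
    rw [hW, LinearMap.mem_ker] at hw ⊢
    simpa [hw] using h2.symm
  have hWne : Nontrivial W := by
    obtain ⟨g, hg⟩ := minpoly.dvd k u hu
    have hg0 : aeval X g ≠ 0 := by
      intro h0
      obtain ⟨g', hg'⟩ := minpoly.dvd k X h0
      have hgne : g ≠ 0 := fun h ↦ minpoly.ne_zero hint (by rw [hg, h, mul_zero])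
      have h1 : g * 1 = g * (minpoly k u * g') := by
        rw [mul_one]; nth_rewrite 1 [hg']; rw [hg]; ring
      exact (minpoly.irreducible (hu_int u)).not_isUnit
        (IsUnit.of_mul_eq_one _ (mul_left_cancel₀ hgne h1).symm)
    obtain ⟨v, hv⟩ := DFunLike.ne_iff.1 hg0
    rw [LinearMap.zero_apply] at hv
    obtain ⟨f', hf'⟩ : minpoly k u ∣ f.comp h := by
      refine minpoly.dvd _ _ ?_
      rw [aeval_comp, hhu, hf, minpoly.aeval]
    refine nontrivial_of_ne (⟨aeval X g v, ?_⟩ : W) 0 (fun h0 ↦ hv (congrArg Subtype.val h0))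
    rw [hW, LinearMap.mem_ker, ← hhX, ← aeval_comp, hf', mul_comm, map_mul, Module.End.mul_apply,
      ← Module.End.mul_apply (aeval X (minpoly k u)), ← map_mul, ← hg, minpoly.aeval]
    simp
  have hfin := two_mul_natDegree_le_finrank (V := W) (minpoly.irreducible (hu_int (u - u⁻¹)))
    (T := T.restrict (hWmap (Commute.refl T))) (X := X.restrict (hWmap hXT))
    (Y := Y.restrict (hWmap hYT)) ?_ ?_ ?_ ?_
  · exact hfin.trans (Submodule.finrank_le W)
  · ext w
    have h1 (p : k[X]) (w : W) :
        (aeval (T.restrict (hWmap (Commute.refl T))) p w : V) = aeval T p w := by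
      induction p using Polynomial.induction_on generalizing w with
      | C a => simp
      | add p q hp hq => simp [hp, hq]
      | monomial i a h =>
        rw [pow_succ, ← mul_assoc, map_mul (aeval (T.restrict _)), map_mul (aeval T),
          Module.End.mul_apply, Module.End.mul_apply, h]
        simp
    rw [h1]
    exact w.2
  · exact LinearMap.ext fun w ↦ Subtype.ext (LinearMap.congr_fun hXT.eq w)
  · exact LinearMap.ext fun w ↦ Subtype.ext (LinearMap.congr_fun hYT.eq w)
  · intro w hw heq
    replace heq : X (Y w) = Y (X w) := congrArg Subtype.val heq
    have h1 : X (X (Y w)) = -Y w := by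
      rw [heq]; exact LinearMap.congr_fun hXY w
    have h2 : (X ^ 2 ^ (n + 2)) (Y w) = Y w := by
      have h3 : 2 ^ (n + 2) = 2 * 2 * 2 ^ n := by ring
      rw [h3, pow_mul, pow_mul]
      have h4 : (X ^ 2) ^ 2 = (X * X) * (X * X) := by noncomm_ring
      rw [h4, Module.End.coe_pow]
      refine Function.iterate_fixed ?_ _
      simp [h1]
    rw [hX] at h2
    have h3 : Y w = 0 := by
      have h5 : (-1 : k) ≠ 1 := fun h ↦ hL (by
        simpa using congrArg (algebraMap k (AlgebraicClosure k)) h)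
      have h6 : (-1 : k) • Y w = (1 : k) • Y w := by simpa using h2
      by_contra h0
      exact h5 (smul_left_injective k h0 h6)
    have h4 : Y (Y w) = w := LinearMap.congr_fun hY w
    rw [h3, map_zero] at h4
    exact hw (Subtype.ext h4.symm)

end SemidihedralGroup

section Weights

variable {k E V : Type*} [Field k] [CommGroup E] [AddCommGroup V] [Module k V]

/-- The simultaneous eigenspace of a commutative group of operators with eigenvalues `χ`. -/
def weightSpace (ρ : E →* Module.End k V) (χ : E → k) : Submodule k V :=
  ⨅ c, (ρ c).eigenspace (χ c)

variable {ρ : E →* Module.End k V} {χ : E → k}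

theorem mem_weightSpace {v : V} : v ∈ weightSpace ρ χ ↔ ∀ c, ρ c v = χ c • v := by
  simp [weightSpace]

/-- The character of `E` by which it acts on a nonzero weight space. -/
def weightHom (h : weightSpace ρ χ ≠ ⊥) : E →* k where
  toFun := χ
  map_one' := by
    obtain ⟨v, hv, hv0⟩ := Submodule.exists_mem_ne_zero_of_ne_bot h
    have h1 := mem_weightSpace.1 hv 1
    rw [map_one, Module.End.one_apply] at h1
    exact smul_left_injective k hv0 (by simpa using h1.symm)
  map_mul' a b := by
    obtain ⟨v, hv, hv0⟩ := Submodule.exists_mem_ne_zero_of_ne_bot h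
    have hv' := mem_weightSpace.1 hv
    have h1 := hv' (a * b)
    rw [map_mul, Module.End.mul_apply, hv' b, map_smul, hv' a, smul_smul] at h1
    exact smul_left_injective k hv0 (by simpa [mul_comm] using h1.symm)

theorem weightSpace_mapsTo {Z : Module.End k V} (hZ : ∀ c, Commute (ρ c) Z) {v : V}
    (hv : v ∈ weightSpace ρ χ) : Z v ∈ weightSpace ρ χ := by
  rw [mem_weightSpace] at hv ⊢
  intro c
  rw [← Module.End.mul_apply, (hZ c).eq, Module.End.mul_apply, hv, map_smul]

theorem commute_weight (ρ : E →* Module.End k V) (a b : E) : Commute (ρ a) (ρ b) :=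
  (Commute.all a b).map ρ

theorem weight_eq_one_or (hE : ∀ c : E, c * c = 1) (h : weightSpace ρ χ ≠ ⊥) (c : E) :
    χ c = 1 ∨ χ c = -1 := by
  rw [← mul_self_eq_one_iff]
  change weightHom h c * weightHom h c = 1
  rw [← map_mul, hE, map_one]

theorem maxGenEigenspace_eq_eigenspace_of_mul_self (h2 : (2 : k) ≠ 0) {f : Module.End k V}
    (hf : f * f = 1) (μ : k) : f.maxGenEigenspace μ = f.eigenspace μ := by
  refine Module.End.IsFinitelySemisimple.maxGenEigenspace_eq_eigenspace ?_ μ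
  refine Module.End.IsSemisimple.isFinitelySemisimple ?_
  refine Module.End.isSemisimple_of_squarefree_aeval_eq_zero (p := X ^ 2 - 1) ?_ (by simp [sq, hf])
  have := Polynomial.separable_X_pow_sub_C (1 : k) (n := 2) (by exact_mod_cast h2) one_ne_zero
  simpa using this.squarefree

theorem weightSpace_eq_iInf_maxGenEigenspace (h2 : (2 : k) ≠ 0) (hE : ∀ c : E, c * c = 1)
    (ρ : E →* Module.End k V) (χ : E → k) :
    weightSpace ρ χ = ⨅ c, (ρ c).maxGenEigenspace (χ c) := by
  refine iInf_congr fun c ↦ (maxGenEigenspace_eq_eigenspace_of_mul_self h2 ?_ _).symm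
  rw [← map_mul, hE, map_one]

theorem iSupIndep_weightSpace (h2 : (2 : k) ≠ 0) (hE : ∀ c : E, c * c = 1)
    (ρ : E →* Module.End k V) : iSupIndep (weightSpace ρ) := by
  rw [funext (weightSpace_eq_iInf_maxGenEigenspace h2 hE ρ)]
  exact Module.End.independent_iInf_maxGenEigenspace_of_forall_mapsTo _ fun i j φ ↦
    Module.End.mapsTo_maxGenEigenspace_of_comm (commute_weight ρ j i) φ

variable [FiniteDimensional k V]

theorem iSup_weightSpace (h2 : (2 : k) ≠ 0) (hE : ∀ c : E, c * c = 1)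
    (ρ : E →* Module.End k V) : ⨆ χ, weightSpace ρ χ = ⊤ := by
  rw [funext (weightSpace_eq_iInf_maxGenEigenspace h2 hE ρ)]
  refine
    Module.End.iSup_iInf_maxGenEigenspace_eq_top_of_iSup_maxGenEigenspace_eq_top_of_commute _
      (fun i j _ ↦ commute_weight ρ i j) fun c ↦ ?_
  have hc : ρ c * ρ c = 1 := by rw [← map_mul, hE, map_one]
  rw [eq_top_iff]
  intro v _
  have h1 : v = (2 : k)⁻¹ • (v + ρ c v) + (2 : k)⁻¹ • (v - ρ c v) := by
    rw [← smul_add, add_add_sub_cancel, ← two_smul k v, smul_smul, inv_mul_cancel₀ h2, one_smul]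
  have h3 : ρ c (ρ c v) = v := LinearMap.congr_fun hc v
  rw [h1]
  refine add_mem ?_ ?_ <;> refine Submodule.smul_mem _ _ ?_
  · refine Submodule.mem_iSup_of_mem 1 ?_
    rw [maxGenEigenspace_eq_eigenspace_of_mul_self h2 hc, Module.End.mem_eigenspace_iff]
    simp [h3, add_comm]
  · refine Submodule.mem_iSup_of_mem (-1) ?_
    rw [maxGenEigenspace_eq_eigenspace_of_mul_self h2 hc, Module.End.mem_eigenspace_iff]
    simp [h3]

theorem finite_weights (h2 : (2 : k) ≠ 0) (hE : ∀ c : E, c * c = 1) (ρ : E →* Module.End k V) :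
    {χ | weightSpace ρ χ ≠ ⊥}.Finite :=
  WellFoundedGT.finite_ne_bot_of_iSupIndep (iSupIndep_weightSpace h2 hE ρ)

/-- The nontrivial weights of a commutative group of involutions. -/
noncomputable def nontrivialWeights (h2 : (2 : k) ≠ 0) (hE : ∀ c : E, c * c = 1)
    (ρ : E →* Module.End k V) : Finset (E → k) :=
  open scoped Classical in (finite_weights h2 hE ρ).toFinset.erase 1

theorem mem_nontrivialWeights (h2 : (2 : k) ≠ 0) (hE : ∀ c : E, c * c = 1) :
    χ ∈ nontrivialWeights h2 hE ρ ↔ χ ≠ 1 ∧ weightSpace ρ χ ≠ ⊥ := by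
  simp [nontrivialWeights]

theorem card_le_two_pow_card_nontrivialWeights (h2 : (2 : k) ≠ 0) (hE : ∀ c : E, c * c = 1)
    (hρ : Function.Injective ρ) : Nat.card E ≤ 2 ^ (nontrivialWeights h2 hE ρ).card := by
  have hcard : Nat.card (nontrivialWeights h2 hE ρ → Prop) =
      2 ^ (nontrivialWeights h2 hE ρ).card := by
    rw [Nat.card_fun]; simp
  rw [← hcard]
  refine Nat.card_le_card_of_injective (fun c χ ↦ χ.1 c = 1) fun a b hab ↦ hρ ?_
  have hle : ⨆ χ, weightSpace ρ χ ≤ LinearMap.eqLocus (ρ a) (ρ b) := by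
    refine iSup_le fun χ v hv ↦ ?_
    by_cases h : weightSpace ρ χ = ⊥
    · rw [h, Submodule.mem_bot] at hv
      simp [hv]
    rw [LinearMap.mem_eqLocus, mem_weightSpace.1 hv, mem_weightSpace.1 hv]
    congr 1
    by_cases h1 : χ = 1
    · rw [h1]; rfl
    have h3 := congrFun hab ⟨χ, (mem_nontrivialWeights h2 hE).2 ⟨h1, h⟩⟩
    have h4 : χ a = 1 ↔ χ b = 1 := iff_of_eq h3
    rcases weight_eq_one_or hE h a with ha | ha <;> rcases weight_eq_one_or hE h b with hb | hb <;>
      grind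
  rw [iSup_weightSpace h2 hE, top_le_iff] at hle
  exact LinearMap.ext fun v ↦ LinearMap.mem_eqLocus.1 (hle ▸ Submodule.mem_top)

theorem sum_finrank_weightSpace_le (h2 : (2 : k) ≠ 0) (hE : ∀ c : E, c * c = 1)
    (ρ : E →* Module.End k V) (S : Finset (E → k)) :
    ∑ χ ∈ S, Module.finrank k (weightSpace ρ χ) ≤ Module.finrank k V := by
  classical
  suffices h : ∑ χ ∈ S, Module.finrank k (weightSpace ρ χ) =
      Module.finrank k (S.sup (weightSpace ρ) : Submodule k V) from h ▸ Submodule.finrank_le _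
  induction S using Finset.induction_on with
  | empty => rw [Finset.sum_empty, Finset.sup_empty, finrank_bot]
  | insert χ S hχ ih =>
    have h1 := Submodule.finrank_sup_add_finrank_inf_eq (weightSpace ρ χ) (S.sup (weightSpace ρ))
    have h3 : Disjoint (weightSpace ρ χ) (S.sup (weightSpace ρ)) :=
      ((iSupIndep_weightSpace h2 hE ρ).supIndep' (insert χ S))
        (Finset.subset_insert χ S) (Finset.mem_insert_self χ S) hχ
    rw [h3.eq_bot, finrank_bot, add_zero] at h1
    rw [Finset.sum_insert hχ, ih, Finset.sup_insert, h1]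

end Weights

namespace SemidihedralGroup

theorem ofUnits_prod_mul_self (m : ℕ) (c : (Fin m → ℤˣ) × ℤˣ) : c * c = 1 :=
  Prod.ext (funext fun i ↦ Int.units_mul_self (c.1 i)) (Int.units_mul_self c.2)

/-- The embedding of the elementary abelian group of rank `m + 1` in the centre of the product of
`m` semidihedral groups with a group of order two. -/
def ofUnitsProd (n m : ℕ) : (Fin m → ℤˣ) × ℤˣ →* (Fin m → SemidihedralGroup n) × ℤˣ :=
  ((ofUnits n).compLeft (Fin m)).prodMap (MonoidHom.id ℤˣ)

theorem ofUnitsProd_injective (n m : ℕ) : Function.Injective (ofUnitsProd n m) := by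
  rintro ⟨c, u⟩ ⟨c', u'⟩ h
  have h1 := congrArg Prod.fst h
  have h2 := congrArg Prod.snd h
  exact Prod.ext (funext fun i ↦ ofUnits_injective (congrFun h1 i)) h2

theorem commute_ofUnitsProd {n m : ℕ} (c : (Fin m → ℤˣ) × ℤˣ)
    (g : (Fin m → SemidihedralGroup n) × ℤˣ) : Commute (ofUnitsProd n m c) g :=
  Prod.ext (funext fun i ↦ commute_ofUnits (c.1 i) (g.1 i)) (mul_comm _ _)

variable {k V : Type*} [Field k] [AddCommGroup V] [Module k V] [FiniteDimensional k V]

theorem two_mul_finrank_le_weightSpace {n m : ℕ} {e : AlgebraicClosure k}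
    (he : IsPrimitiveRoot e (2 ^ (n + 3)))
    (ρ : (Fin m → SemidihedralGroup n) × ℤˣ →* Module.End k V) {χ : (Fin m → ℤˣ) × ℤˣ → k}
    (hχ : weightSpace (ρ.comp (ofUnitsProd n m)) χ ≠ ⊥) {i : Fin m}
    (hi : χ (Pi.mulSingle i (-1), 1) = -1) :
    2 * Module.finrank k (IntermediateField.adjoin k {e - e⁻¹}) ≤
      Module.finrank k (weightSpace (ρ.comp (ofUnitsProd n m)) χ) := by
  set W := weightSpace (ρ.comp (ofUnitsProd n m)) χ with hW
  have : Nontrivial W := Submodule.nontrivial_iff_ne_bot.2 hχ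
  let ι : SemidihedralGroup n →* Module.End k V :=
    ρ.comp ((MonoidHom.inl _ _).comp (MonoidHom.mulSingle (fun _ ↦ SemidihedralGroup n) i))
  have hι (g : SemidihedralGroup n) : ∀ w ∈ W, ι g w ∈ W := fun w hw ↦
    weightSpace_mapsTo (fun c ↦ (commute_ofUnitsProd c _).map ρ) hw
  have hinv (w : V) (hw : w ∈ W) : ι (involution n) w = -w := by
    have h1 := mem_weightSpace.1 hw (Pi.mulSingle i (-1), 1)
    have h2 : ofUnitsProd n m (Pi.mulSingle i (-1), 1) = (Pi.mulSingle i (involution n), 1) := by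
      refine Prod.ext (funext fun j ↦ ?_) rfl
      change ofUnits n ((Pi.mulSingle i (-1) : Fin m → ℤˣ) j) = _
      by_cases hj : j = i
      · subst hj; simp [ofUnits_neg_one]
      · simp [hj]
    rw [hi, MonoidHom.comp_apply, h2, neg_one_smul] at h1
    exact h1
  refine two_mul_finrank_le (X := (ι (rot 1)).restrict (hι (rot 1)))
    (Y := (ι (refl 0)).restrict (hι (refl 0))) (n := n) ?_ ?_ ?_ he
  · refine LinearMap.ext fun w ↦ Subtype.ext ?_
    rw [Module.End.pow_restrict]
    change (ι (rot 1) ^ 2 ^ (n + 2)) (w : V) = -w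
    rw [← map_pow, rot_one_pow_two_pow]
    exact hinv w w.2
  · refine LinearMap.ext fun w ↦ Subtype.ext ?_
    change (ι (refl 0) * ι (refl 0)) (w : V) = w
    rw [← map_mul, refl_mul_self, map_one]
    rfl
  · refine LinearMap.ext fun w ↦ Subtype.ext ?_
    change (ι (rot 1) * ι (refl 0) * ι (rot 1)) (w : V) = -ι (refl 0) w
    rw [← map_mul, ← map_mul, rot_mul_refl_mul_rot, map_mul]
    exact hinv _ (hι _ _ w.2)

theorem finrank_lower_bound (h2 : (2 : k) ≠ 0) {n m : ℕ} {e : AlgebraicClosure k}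
    (he : IsPrimitiveRoot e (2 ^ (n + 3)))
    {ρ : (Fin m → SemidihedralGroup n) × ℤˣ →* Module.End k V} (hρ : Function.Injective ρ) :
    2 * m * Module.finrank k (IntermediateField.adjoin k {e - e⁻¹}) + 1 ≤ Module.finrank k V := by
  classical
  set D := Module.finrank k (IntermediateField.adjoin k {e - e⁻¹})
  have hE := ofUnits_prod_mul_self m
  set σ := ρ.comp (ofUnitsProd n m) with hσ
  have hσinj : Function.Injective σ := hρ.comp (ofUnitsProd_injective n m)
  set S := nontrivialWeights h2 hE σ with hS
  have hcard : m + 1 ≤ S.card := by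
    have h := card_le_two_pow_card_nontrivialWeights h2 hE hσinj
    have h3 : Nat.card ((Fin m → ℤˣ) × ℤˣ) = 2 ^ (m + 1) := by
      rw [Nat.card_prod, Nat.card_fun, Nat.card_eq_fintype_card (α := ℤˣ)]
      simp [pow_succ]
    rw [h3] at h
    exact (Nat.pow_le_pow_iff_right (by norm_num)).1 h
  let χ₀ : (Fin m → ℤˣ) × ℤˣ → k := fun c ↦ ((c.2 : ℤ) : k)
  have hbig : ∀ χ ∈ S.erase χ₀, 2 * D ≤ Module.finrank k (weightSpace σ χ) := by
    intro χ hχ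
    obtain ⟨hne, hχ⟩ := Finset.mem_erase.1 hχ
    obtain ⟨h1, hbot⟩ := (mem_nontrivialWeights h2 hE).1 hχ
    suffices h : ∃ i, χ (Pi.mulSingle i (-1), 1) = -1 by
      obtain ⟨i, hi⟩ := h
      exact two_mul_finrank_le_weightSpace he ρ hbot hi
    by_contra! h
    have hone (i : Fin m) : χ (Pi.mulSingle i (-1), 1) = 1 :=
      (weight_eq_one_or hE hbot _).resolve_right (h i)
    have hleft (c : Fin m → ℤˣ) : χ (c, 1) = 1 := by
      have h4 : (weightHom hbot).comp (MonoidHom.inl (Fin m → ℤˣ) ℤˣ) = 1 := by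
        refine MonoidHom.pi_ext fun i u ↦ ?_
        rcases Int.units_eq_one_or u with rfl | rfl
        · rw [Pi.mulSingle_one, map_one, map_one]
        · exact hone i
      exact DFunLike.congr_fun h4 c
    have hsplit (c : Fin m → ℤˣ) (u : ℤˣ) : χ (c, u) = χ (1, u) := by
      have h5 : ((c, u) : (Fin m → ℤˣ) × ℤˣ) = (c, 1) * (1, u) := by simp
      rw [h5]
      change weightHom hbot _ = _
      rw [map_mul]
      change χ (c, 1) * χ (1, u) = _
      rw [hleft, one_mul]
    rcases weight_eq_one_or hE hbot (1, -1) with h6 | h6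
    · refine h1 (funext fun ⟨c, u⟩ ↦ ?_)
      rw [hsplit]
      rcases Int.units_eq_one_or u with rfl | rfl
      · exact hleft 1
      · exact h6
    · refine hne (funext fun ⟨c, u⟩ ↦ ?_)
      rw [hsplit]
      rcases Int.units_eq_one_or u with rfl | rfl
      · simp [χ₀, hleft]
      · simp [χ₀, h6]
  have hpos : ∀ χ ∈ S, 1 ≤ Module.finrank k (weightSpace σ χ) := fun χ hχ ↦
    Nat.one_le_iff_ne_zero.2 fun h ↦
      ((mem_nontrivialWeights h2 hE).1 hχ).2 (Submodule.finrank_eq_zero.1 h)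
  have hDpos : 1 ≤ D := by
    have := IntermediateField.adjoin.finiteDimensional
      (Algebra.IsIntegral.isIntegral (R := k) (e - e⁻¹))
    exact Module.finrank_pos
  refine le_trans ?_ (sum_finrank_weightSpace_le h2 hE σ S)
  have hsum : (S.erase χ₀).card * (2 * D) ≤
      ∑ χ ∈ S.erase χ₀, Module.finrank k (weightSpace σ χ) := by
    simpa using Finset.card_nsmul_le_sum _ _ _ hbig
  by_cases hmem : χ₀ ∈ S
  · rw [← Finset.sum_erase_add _ _ hmem]
    have h3 := Finset.card_erase_of_mem hmem
    have h4 : m * (2 * D) ≤ (S.erase χ₀).card * (2 * D) := Nat.mul_le_mul_right _ (by omega)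
    have h5 := hpos _ hmem
    have h6 : 2 * m * D = m * (2 * D) := by ring
    omega
  · rw [Finset.erase_eq_of_notMem hmem] at hsum
    have h4 : (m + 1) * (2 * D) ≤ S.card * (2 * D) := Nat.mul_le_mul_right _ hcard
    have h6 : (m + 1) * (2 * D) = 2 * m * D + 2 * D := by ring
    omega

end SemidihedralGroup

theorem exists_injective_generalLinearGroup {k V G : Type*} [Field k] [AddCommGroup V] [Module k V]
    [FiniteDimensional k V] [Group G] {ρ : G →* Module.End k V} (hρ : Function.Injective ρ) :
    ∃ φ : G →* Matrix.GeneralLinearGroup (Fin (Module.finrank k V)) k, Function.Injective φ := by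
  let τ : Module.End k V →* Matrix (Fin (Module.finrank k V)) (Fin (Module.finrank k V)) k :=
    (LinearMap.toMatrixAlgEquiv (Module.finBasis k V)).toMulEquiv.toMonoidHom
  refine ⟨(τ.comp ρ).toHomUnits, fun a b h ↦ hρ ?_⟩
  exact (LinearMap.toMatrixAlgEquiv (Module.finBasis k V)).injective (congrArg Units.val h)

theorem exists_injective_moduleEnd {k G : Type*} [Field k] [Group G] {d : ℕ}
    {φ : G →* Matrix.GeneralLinearGroup (Fin d) k} (hφ : Function.Injective φ) :
    ∃ ρ : G →* Module.End k (Fin d → k), Function.Injective ρ := by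
  let τ : Matrix (Fin d) (Fin d) k →* Module.End k (Fin d → k) :=
    (Matrix.toLinAlgEquiv' (R := k) (n := Fin d)).toMulEquiv.toMonoidHom
  refine ⟨τ.comp ((Units.coeHom _).comp φ), fun a b h ↦ hφ (Units.ext ?_)⟩
  exact (Matrix.toLinAlgEquiv' (R := k) (n := Fin d)).injective h

section Wreath

variable (m : ℕ) (G : Type*) [Group G]

/-- The wreath product of `G` with the symmetric group on `m` letters. -/
abbrev SymmWreath : Type _ := (Fin m → G) ⋊[mulAutArrow (G := Equiv.Perm (Fin m))] Equiv.Perm (Fin m)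

theorem card_symmWreath : Nat.card (SymmWreath m G) = Nat.card G ^ m * m.factorial := by
  rw [SemidirectProduct.card, Nat.card_fun, Nat.card_perm, Nat.card_fin]

variable {m G} {k V : Type*} [Field k] [AddCommGroup V] [Module k V]

/-- The action of the wreath product on `m` copies of a representation of `G`. -/
def wreathRep (ρ : G →* Module.End k V) : SymmWreath m G →* Module.End k (Fin m → V) where
  toFun g := LinearMap.pi fun i ↦ ρ (g.left i) ∘ₗ LinearMap.proj (g.right⁻¹ i)
  map_one' := by ext; simp
  map_mul' g h := by
    refine LinearMap.ext fun v ↦ funext fun i ↦ ?_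
    simp [mul_inv_rev, mulAutArrow]
    rfl

theorem wreathRep_injective [Nontrivial V] {ρ : G →* Module.End k V}
    (hρ : Function.Injective ρ) : Function.Injective (wreathRep (m := m) ρ) := by
  rw [injective_iff_map_eq_one]
  rintro ⟨g, σ⟩ h
  have h1 (v : Fin m → V) (i : Fin m) : ρ (g i) (v (σ⁻¹ i)) = v i :=
    congrFun (LinearMap.congr_fun h v) i
  have hσ : σ = 1 := by
    refine Equiv.ext fun i ↦ ?_
    by_contra (hne : σ i ≠ i)
    obtain ⟨w, hw⟩ := exists_ne (0 : V)
    have h2 := h1 (Pi.single i w) (σ i)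
    rw [show σ⁻¹ (σ i) = i from σ.symm_apply_apply i, Pi.single_eq_same, Pi.single_eq_of_ne hne] at h2
    have h3 : ρ (g (σ i))⁻¹ (ρ (g (σ i)) w) = w := by
      rw [← Module.End.mul_apply, ← map_mul, inv_mul_cancel, map_one]; rfl
    rw [h2, map_zero] at h3
    exact hw h3.symm
  subst hσ
  refine SemidirectProduct.ext (funext fun i ↦ hρ ?_) rfl
  refine LinearMap.ext fun w ↦ ?_
  simpa using h1 (fun _ ↦ w) i

/-- The action of the product of the wreath product with a group of order two on the sum of `m`
copies of a representation of `G` and the sign representation. -/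
def wreathProdRep (ρ : G →* Module.End k V) :
    SymmWreath m G × ℤˣ →* Module.End k ((Fin m → V) × k) where
  toFun g := (wreathRep ρ g.1).prodMap (((g.2 : ℤ) : k) • LinearMap.id)
  map_one' := by ext <;> simp
  map_mul' g h := by
    refine LinearMap.ext fun v ↦ Prod.ext ?_ ?_
    · simp
    · simp [mul_assoc]

theorem wreathProdRep_injective [Nontrivial V] (h2 : (2 : k) ≠ 0) {ρ : G →* Module.End k V}
    (hρ : Function.Injective ρ) : Function.Injective (wreathProdRep (m := m) ρ) := by
  rw [injective_iff_map_eq_one]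
  rintro ⟨g, u⟩ h
  refine Prod.ext ((injective_iff_map_eq_one _).1 (wreathRep_injective hρ) g ?_) ?_
  · exact LinearMap.ext fun v ↦ congrArg Prod.fst (LinearMap.congr_fun h (v, 0))
  · have h3 : ((u : ℤ) : k) • (1 : k) = 1 := congrArg Prod.snd (LinearMap.congr_fun h (0, 1))
    rcases Int.units_eq_one_or u with rfl | rfl
    · rfl
    · exfalso
      apply h2
      simp at h3
      linear_combination -h3

theorem exists_injective_wreathProd [FiniteDimensional k V] [Nontrivial V] (h2 : (2 : k) ≠ 0)
    {ρ : G →* Module.End k V} (hρ : Function.Injective ρ) :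
    ∃ φ : SymmWreath m G × ℤˣ →*
      Matrix.GeneralLinearGroup (Fin (m * Module.finrank k V + 1)) k, Function.Injective φ := by
  have h := exists_injective_generalLinearGroup (wreathProdRep_injective (m := m) h2 hρ)
  have h3 : Module.finrank k ((Fin m → V) × k) = m * Module.finrank k V + 1 := by
    simp [Module.finrank_prod, Module.finrank_pi_fintype]
  rwa [h3] at h

end Wreath

namespace SemidihedralGroup

theorem exists_injective_moduleEnd_of_algebra {k K L : Type*} [Field k] [Field K] [Field L]
    [Algebra k K] [Algebra K L] {n : ℕ} {e : L} (he : IsPrimitiveRoot e (2 ^ (n + 3))) {a : K}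
    (ha : algebraMap K L a = e - e⁻¹) :
    ∃ ρ : SemidihedralGroup n →* Module.End k (Fin 2 → K), Function.Injective ρ := by
  obtain ⟨f, hf⟩ := exists_injective_matrix he ha
  refine ⟨{ toFun g := (Matrix.toLin' (f g)).restrictScalars k, map_one' := ?_, map_mul' := ?_ },
    fun a b h ↦ hf (Matrix.toLin'.injective (LinearMap.restrictScalars_injective k h))⟩
  · rw [map_one, Matrix.toLin'_one]; rfl
  · intro g h
    rw [map_mul, Matrix.toLin'_mul]; rfl

theorem exists_injective_wreathProd_of_algebra {k K L : Type*} [Field k] [Field K] [Field L]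
    [Algebra k K] [Algebra K L] [FiniteDimensional k K] (h2 : (2 : k) ≠ 0) {n m : ℕ} {e : L}
    (he : IsPrimitiveRoot e (2 ^ (n + 3))) {a : K} (ha : algebraMap K L a = e - e⁻¹) :
    ∃ φ : SymmWreath m (SemidihedralGroup n) × ℤˣ →*
      Matrix.GeneralLinearGroup (Fin (2 * m * Module.finrank k K + 1)) k, Function.Injective φ := by
  obtain ⟨ρ, hρ⟩ := exists_injective_moduleEnd_of_algebra (k := k) he ha
  have h := exists_injective_wreathProd (m := m) h2 hρ
  have h3 : m * Module.finrank k (Fin 2 → K) = 2 * m * Module.finrank k K := by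
    rw [Module.finrank_pi_fintype]; simp; ring
  rwa [h3] at h

end SemidihedralGroup

/-- The element `e - e⁻¹` is fixed by the Frobenius automorphism. -/
theorem FiniteField.exists_algebraMap_eq_sub_inv {F : Type*} [Field F] [Fintype F] {n c : ℕ}
    (hc : Odd c) (hF : Fintype.card F + 1 = 2 ^ (n + 2) * c) {e : AlgebraicClosure F}
    (he : IsPrimitiveRoot e (2 ^ (n + 3))) :
    ∃ a : F, algebraMap F (AlgebraicClosure F) a = e - e⁻¹ := by
  obtain ⟨p, hp⟩ := CharP.exists F
  obtain ⟨r, hpp, hr⟩ := FiniteField.card F p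
  have : Fact p.Prime := ⟨hpp⟩
  have hpA : CharP (AlgebraicClosure F) p := charP_of_injective_algebraMap
    (algebraMap F (AlgebraicClosure F)).injective p
  have he0 : e ≠ 0 := he.ne_zero (by positivity)
  have h1 : e ^ Fintype.card F = -e⁻¹ := by
    have h2 : e ^ (Fintype.card F + 1) = -1 := by
      rw [hF, pow_mul, he.pow_two_pow_eq_neg_one, hc.neg_one_pow]
    rw [pow_succ] at h2
    field_simp
    linear_combination h2
  have h3 : (e - e⁻¹) ^ Fintype.card F = e - e⁻¹ := by
    have h4 : (e - e⁻¹) ^ Fintype.card F = e ^ Fintype.card F - e⁻¹ ^ Fintype.card F := by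
      rw [hr]; exact sub_pow_char_pow _ _ _
    rw [h4, inv_pow, h1, inv_neg, inv_inv]
    ring
  have h5 : (e - e⁻¹) ∈ ((X ^ Fintype.card F - X : F[X]).map
      (algebraMap F (AlgebraicClosure F))).roots := by
    rw [mem_roots_map_of_injective (algebraMap F _).injective
      (FiniteField.X_pow_card_sub_X_ne_zero F Fintype.one_lt_card)]
    simp [h3]
  have h6 : (X ^ Fintype.card F - X : F[X]).Splits := by
    rw [splits_iff_card_roots, FiniteField.roots_X_pow_card_sub_X,
      FiniteField.X_pow_card_sub_X_natDegree_eq F Fintype.one_lt_card]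
    rfl
  rw [h6.roots_map, FiniteField.roots_X_pow_card_sub_X] at h5
  obtain ⟨a, -, ha⟩ := Multiset.mem_map.1 h5
  exact ⟨a, ha⟩

section Valuation

theorem padicValNat_two_pow_odd_sub_one {q : ℕ} (hq : q % 4 = 3) (j : ℕ) :
    padicValNat 2 (q ^ (2 * j + 1) - 1) = 1 := by
  have h1 : q ^ (2 * j + 1) % 4 = 3 := by
    rw [pow_succ, pow_mul, Nat.mul_mod, Nat.pow_mod, Nat.pow_mod q, hq]
    simp
  obtain ⟨c, hc⟩ : ∃ c, q ^ (2 * j + 1) - 1 = 2 ^ 1 * (2 * c + 1) :=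
    ⟨q ^ (2 * j + 1) / 4, by omega⟩
  rw [hc, padicValNat.mul (by positivity) (by positivity), padicValNat.prime_pow,
    padicValNat.eq_zero_of_not_dvd (by omega)]

theorem padicValNat_two_pow_even_sub_one {q : ℕ} (hq : q % 4 = 3) (j : ℕ) :
    padicValNat 2 (q ^ (2 * (j + 1)) - 1) =
      padicValNat 2 (q + 1) + 1 + padicValNat 2 (j + 1) := by
  have h1 := padicValNat.pow_two_sub_one (x := q) (n := 2 * (j + 1)) (by omega) (by omega)
    (by omega) (even_two_mul _)
  have h2 := padicValNat_two_pow_odd_sub_one hq 0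
  rw [padicValNat.mul (by norm_num) (by omega), padicValNat_self] at h1
  simp only [mul_zero, zero_add, pow_one] at h2
  omega

theorem sum_padicValNat_two_pow_sub_one {q : ℕ} (hq : q % 4 = 3) (m : ℕ) :
    ∑ i ∈ Finset.range (2 * m + 1), padicValNat 2 (q ^ (i + 1) - 1) =
      (padicValNat 2 (q + 1) + 2) * m + padicValNat 2 m.factorial + 1 := by
  induction m with
  | zero => simpa using padicValNat_two_pow_odd_sub_one hq 0
  | succ m ih =>
    rw [show 2 * (m + 1) + 1 = 2 * m + 1 + 1 + 1 by ring, Finset.sum_range_succ,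
      Finset.sum_range_succ, ih, show 2 * m + 1 + 1 + 1 = 2 * (m + 1) + 1 by ring,
      show 2 * m + 1 + 1 = 2 * (m + 1) by ring, padicValNat_two_pow_odd_sub_one hq,
      padicValNat_two_pow_even_sub_one hq, Nat.factorial_succ,
      padicValNat.mul (by omega) (Nat.factorial_ne_zero m)]
    ring

theorem padicValNat_two_card_generalLinearGroup {F : Type*} [Field F] [Fintype F]
    (hq : Fintype.card F % 4 = 3) (m : ℕ) :
    padicValNat 2 (Nat.card (Matrix.GeneralLinearGroup (Fin (2 * m + 1)) F)) =
      (padicValNat 2 (Fintype.card F + 1) + 2) * m + padicValNat 2 m.factorial + 1 := by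
  rw [← sum_padicValNat_two_pow_sub_one hq, Matrix.card_GL_field]
  generalize Fintype.card F = q at hq
  generalize 2 * m + 1 = N
  have h1 (i : ℕ) (hi : i < N) : q ^ N - q ^ i = q ^ i * (q ^ (N - 1 - i + 1) - 1) := by
    rw [Nat.mul_sub, ← pow_add, mul_one]
    congr 2
    omega
  have h2 (i : ℕ) : q ^ (i + 1) - 1 ≠ 0 :=
    (Nat.sub_pos_of_lt (Nat.one_lt_pow (by omega) (by omega))).ne'
  rw [Fin.prod_univ_eq_prod_range (fun i ↦ q ^ N - q ^ i) N,
    ← Finset.sum_range_reflect, ← Nat.factorization_def _ Nat.prime_two, Nat.factorization_prod]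
  · rw [Finsupp.finsetSum_apply]
    refine Finset.sum_congr rfl fun i hi ↦ ?_
    rw [Nat.factorization_def _ Nat.prime_two, h1 i (Finset.mem_range.1 hi),
      padicValNat.mul (pow_ne_zero _ (by omega)) (h2 _),
      padicValNat.eq_zero_of_not_dvd (n := q ^ i), zero_add]
    intro h
    have := Nat.prime_two.dvd_of_dvd_pow h
    omega
  · intro i hi
    rw [h1 i (Finset.mem_range.1 hi)]
    exact mul_ne_zero (pow_ne_zero _ (by omega)) (h2 _)

theorem padicValNat_two_card_symmWreath_prod (m n : ℕ) :
    padicValNat 2 (Nat.card (SymmWreath m (SemidihedralGroup n) × ℤˣ)) =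
      (n + 4) * m + padicValNat 2 m.factorial + 1 := by
  have h : Nat.card ℤˣ = 2 ^ 1 := by simp
  rw [Nat.card_prod, card_symmWreath, SemidihedralGroup.card, h, ← pow_mul,
    padicValNat.mul (mul_ne_zero (by positivity) (Nat.factorial_ne_zero m)) (by positivity),
    padicValNat.mul (by positivity) (Nat.factorial_ne_zero m), padicValNat.prime_pow,
    padicValNat.prime_pow]

end Valuation

section Sylow

variable {p : ℕ} [Fact p.Prime] {G M A : Type*} [Group G] [Finite G] [Group M] [Group A]

/-- A group with the same `p`-part of the order embedded in `G` contains the Sylow `p`-subgroups of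
`G` up to isomorphism. -/
theorem Sylow.exists_injective_of_padicValNat_eq {φ : M →* G} (hφ : Function.Injective φ)
    (h : padicValNat p (Nat.card M) = padicValNat p (Nat.card G)) (P : Sylow p G) :
    ∃ f : P →* M, Function.Injective f := by
  have : Finite M := Finite.of_injective φ hφ
  obtain ⟨Q⟩ : Nonempty (Sylow p M) := inferInstance
  have hp : p.Prime := Fact.out
  have hQ : Nat.card (Q.1.map φ) = p ^ (Nat.card G).factorization p := by
    rw [Nat.card_congr (Q.1.equivMapOfInjective φ hφ).symm.toEquiv, Nat.factorization_def _ hp, ← h,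
      ← Nat.factorization_def _ hp]
    exact Q.card_eq_multiplicity
  let e : P ≃* Q := (P.equiv (Sylow.ofCard _ hQ)).trans (Q.1.equivMapOfInjective φ hφ).symm
  exact ⟨Q.1.subtype.comp e.toMonoidHom, Q.1.subtype_injective.comp e.injective⟩

theorem Sylow.exists_injective_of_isPGroup {φ : A →* G} (hφ : Function.Injective φ)
    (hA : IsPGroup p A) (P : Sylow p G) : ∃ f : A →* P, Function.Injective f := by
  obtain ⟨Q, hQ⟩ := (hA.of_equiv (φ.ofInjective hφ)).exists_le_sylow
  exact ⟨(Q.equiv P).toMonoidHom.comp ((Subgroup.inclusion hQ).comp φ.rangeRestrict),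
    (Q.equiv P).injective.comp ((Subgroup.inclusion_injective hQ).comp
      (φ.rangeRestrict_injective_iff.2 hφ))⟩

end Sylow

theorem SemidihedralGroup.isPGroup_pi_prod (m n : ℕ) :
    IsPGroup 2 ((Fin m → SemidihedralGroup n) × ℤˣ) := by
  refine IsPGroup.of_card (n := (n + 4) * m + 1) ?_
  have h : Nat.card ℤˣ = 2 := by simp
  rw [Nat.card_prod, Nat.card_fun, SemidihedralGroup.card, h, Nat.card_fin, ← pow_mul, pow_succ]

/-- The Sylow `2`-subgroups of `GL₂ₘ₊₁` over a finite field with `q ≡ 3 mod 4` elements lie between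
a product of semidihedral groups and a wreath product. -/
theorem exists_injective_sylow_generalLinearGroup {F : Type*} [Field F] [Fintype F] {n : ℕ}
    (hq : Fintype.card F % 4 = 3) (hn : padicValNat 2 (Fintype.card F + 1) = n + 2) {m : ℕ}
    (P : Sylow 2 (Matrix.GeneralLinearGroup (Fin (2 * m + 1)) F)) :
    (∃ f : P →* SymmWreath m (SemidihedralGroup n) × ℤˣ, Function.Injective f) ∧
      ∃ f : (Fin m → SemidihedralGroup n) × ℤˣ →* P, Function.Injective f := by
  obtain ⟨j, c, hc, hjc⟩ := Nat.exists_eq_two_pow_mul_odd (Nat.succ_ne_zero (Fintype.card F))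
  have hj : j = n + 2 := by
    rw [← hn, ← Nat.succ_eq_add_one, hjc, padicValNat.mul (by positivity) hc.pos.ne',
      padicValNat.prime_pow, padicValNat.eq_zero_of_not_dvd hc.not_two_dvd_nat, add_zero]
  subst hj
  have h2 : (2 : F) ≠ 0 := by
    refine Ring.two_ne_zero fun h ↦ ?_
    have := FiniteField.even_card_of_char_two h
    omega
  have : NeZero ((2 : ℕ) : F) := ⟨by exact_mod_cast h2⟩
  obtain ⟨e, he⟩ := HasEnoughRootsOfUnity.exists_primitiveRoot (AlgebraicClosure F) (2 ^ (n + 3))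
  obtain ⟨a, ha⟩ := FiniteField.exists_algebraMap_eq_sub_inv hc hjc he
  have hex := SemidihedralGroup.exists_injective_wreathProd_of_algebra (k := F) (m := m) h2 he ha
  rw [Module.finrank_self, mul_one] at hex
  obtain ⟨φ, hφ⟩ := hex
  refine ⟨P.exists_injective_of_padicValNat_eq hφ ?_, P.exists_injective_of_isPGroup
    (φ := φ.comp ((SemidirectProduct.inl).prodMap (MonoidHom.id _)))
    (hφ.comp (SemidirectProduct.inl_injective.prodMap Function.injective_id))
    (SemidihedralGroup.isPGroup_pi_prod m n)⟩
  rw [padicValNat_two_card_symmWreath_prod, padicValNat_two_card_generalLinearGroup hq, hn]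

theorem stmt2 (p r q s : ℕ) (hp : p.Prime) (hodd : p ≠ 2) (hr : 1 ≤ r)
    (hq : q = p ^ r) (hq4 : q % 4 = 3) (hs : s = padicValNat 2 (q + 1) + 1)
    (k : Type*) [Field k] (hchar : ringChar k ≠ 2)
    (ε : AlgebraicClosure k) (hε : IsPrimitiveRoot ε (2 ^ s))
    (F : Type*) [Field F] [Fintype F] (hF : Fintype.card F = q)
    (m : ℕ) (hm : 1 ≤ m)
    (P : Sylow 2 (Matrix.GeneralLinearGroup (Fin (2 * m + 1)) F)) :
    minFaithfulDim k (P : Subgroup (Matrix.GeneralLinearGroup (Fin (2 * m + 1)) F)) =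
      2 * m * Module.finrank k (IntermediateField.adjoin k {ε - ε⁻¹}) + 1 := by
  have h2 : (2 : k) ≠ 0 := Ring.two_ne_zero hchar
  have h4 : 2 ≤ padicValNat 2 (q + 1) :=
    (padicValNat_dvd_iff_le (by omega)).1 (by norm_num; omega)
  obtain ⟨n, hn⟩ := Nat.exists_eq_add_of_le' h4
  obtain rfl : s = n + 3 := by omega
  subst hF
  obtain ⟨⟨f, hf⟩, g, hg⟩ := exists_injective_sylow_generalLinearGroup hq4 hn P
  have hfin : FiniteDimensional k (IntermediateField.adjoin k {ε - ε⁻¹}) :=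
    IntermediateField.adjoin.finiteDimensional (Algebra.IsIntegral.isIntegral _)
  obtain ⟨φ, hφ⟩ := SemidihedralGroup.exists_injective_wreathProd_of_algebra (k := k) (m := m) h2
    hε (IntermediateField.AdjoinSimple.algebraMap_gen k (ε - ε⁻¹))
  have hmem : 2 * m * Module.finrank k (IntermediateField.adjoin k {ε - ε⁻¹}) + 1 ∈
      {d : ℕ | ∃ φ : P →* Matrix.GeneralLinearGroup (Fin d) k, Function.Injective φ} :=
    ⟨φ.comp f, hφ.comp hf⟩
  refine le_antisymm (Nat.sInf_le hmem) (le_csInf ⟨_, hmem⟩ ?_)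
  rintro d ⟨ψ, hψ⟩
  obtain ⟨ρ, hρ⟩ := exists_injective_moduleEnd (φ := ψ.comp g) (hψ.comp hg)
  simpa using SemidihedralGroup.finrank_lower_bound h2 hε hρ
end
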